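/- arXiv:2108.10380 — 2 statements merged into one kernel-verified Lean document; each statement's English description precedes it below -/
import Mathlib

section
/- Let 1 < p < ∞, let (Ω, Σ, μ) be a measure space, and let (T_t)_{t≥0} be an operator semigroup on L^p(Ω, μ). Assume that for every f ∈ L^p(Ω, μ) and every sequence t_n → 0⁺ one has T_{t_n} f → f μ-almost everywhere on Ω (in the paper this pointwise convergence is supplied by boundedness of all point evaluation functionals). Then (T_t)_{t≥0} is strongly continuous on L^p(Ω, μ) if and only if sup_{0 ≤ t < 1} ‖T_t‖ < ∞. -/
open MeasureTheory Filter Topology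
open scoped ENNReal NNReal

section Semigroup

variable {𝕜 X : Type*} [NontriviallyNormedField 𝕜] [NormedAddCommGroup X] [NormedSpace 𝕜 X]

theorem semigroup_nat_mul (T : ℝ → X →L[𝕜] X) (hT0 : T 0 = ContinuousLinearMap.id 𝕜 X)
    (hT : ∀ s t : ℝ, 0 ≤ s → 0 ≤ t → T (s + t) = (T s).comp (T t)) {t : ℝ} (ht : 0 ≤ t) (n : ℕ) :
    T (n * t) = T t ^ n := by
  induction n with
  | zero =>
    rw [Nat.cast_zero, zero_mul, pow_zero, hT0]
    rfl
  | succ n ih =>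
    rw [Nat.cast_succ, add_mul, one_mul, hT _ _ (by positivity) ht, ih, pow_succ]
    rfl

theorem exists_norm_le_of_forall_tendsto [CompleteSpace X] (T : ℝ → X →L[𝕜] X)
    (h : ∀ f, Tendsto (fun t => T t f) (𝓝[>] (0 : ℝ)) (𝓝 f)) :
    ∃ δ > 0, ∃ C : ℝ, ∀ t ∈ Set.Ioo (0 : ℝ) δ, ‖T t‖ ≤ C := by
  by_contra! hcon
  have hpos (n : ℕ) : (0 : ℝ) < 1 / ((n : ℝ) + 1) := by positivity
  choose t ht htn using fun n : ℕ => hcon (1 / ((n : ℝ) + 1)) (hpos n) n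
  have hlim : Tendsto t atTop (𝓝[>] 0) :=
    tendsto_nhdsWithin_iff.2 ⟨squeeze_zero (fun n => (ht n).1.le) (fun n => (ht n).2.le)
      tendsto_one_div_add_atTop_nhds_zero_nat, Eventually.of_forall fun n => (ht n).1⟩
  obtain ⟨C, hC⟩ := banach_steinhaus (g := fun n => T (t n)) fun f => by
    obtain ⟨C, hC⟩ := ((h f).comp hlim).norm.bddAbove_range
    exact ⟨C, fun n => hC ⟨n, rfl⟩⟩
  obtain ⟨n, hn⟩ := exists_nat_gt C
  linarith [hC n, htn n]

theorem exists_norm_le_Ico_of_forall_tendsto [CompleteSpace X] (T : ℝ → X →L[𝕜] X)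
    (hT0 : T 0 = ContinuousLinearMap.id 𝕜 X)
    (hT : ∀ s t : ℝ, 0 ≤ s → 0 ≤ t → T (s + t) = (T s).comp (T t))
    (h : ∀ f, Tendsto (fun t => T t f) (𝓝[>] (0 : ℝ)) (𝓝 f)) :
    ∃ M : ℝ, ∀ t ∈ Set.Ico (0 : ℝ) 1, ‖T t‖ ≤ M := by
  obtain ⟨δ, hδ, C, hC⟩ := exists_norm_le_of_forall_tendsto T h
  obtain ⟨n, hn⟩ := exists_nat_one_div_lt hδ
  refine ⟨max C 1 ^ (n + 1), fun t ht => ?_⟩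
  have hn0 : (0 : ℝ) < (n : ℝ) + 1 := by positivity
  have htn : 0 ≤ t / (n + 1) := div_nonneg ht.1 hn0.le
  have key := semigroup_nat_mul T hT0 hT htn (n + 1)
  rw [Nat.cast_succ, mul_div_cancel₀ t hn0.ne'] at key
  rw [key]
  refine (norm_pow_le' _ n.succ_pos).trans (pow_le_pow_left₀ (norm_nonneg _) ?_ _)
  rcases htn.eq_or_lt with h0 | h0
  · rw [← h0, hT0]
    exact ContinuousLinearMap.norm_id_le.trans (le_max_right _ _)
  · refine (hC _ ⟨h0, lt_of_le_of_lt ?_ hn⟩).trans (le_max_left _ _)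
    exact div_le_div_of_nonneg_right ht.2.le hn0.le

end Semigroup

section ConvexHull

variable {X : Type*} [NormedAddCommGroup X] [NormedSpace ℝ X]

/-- Right continuity of the orbits of `T` in the sense of closed convex sets. -/
def ConvexRightContinuous (T : ℝ → X →L[ℝ] X) : Prop :=
  ∀ (g : X) (u : ℕ → ℝ), (∀ n, u n ∈ Set.Ico (0 : ℝ) 1) → Tendsto u atTop (𝓝 0) →
    ∀ K : Set X, IsClosed K → Convex ℝ K → (∀ n, T (u n) g ∈ K) → g ∈ K

namespace ConvexRightContinuous

variable {T : ℝ → X →L[ℝ] X}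

theorem mem_of_frequently (hK : ConvexRightContinuous T)
    (hT : ∀ s t : ℝ, 0 ≤ s → 0 ≤ t → T (s + t) = (T s).comp (T t)) (f : X) {s : ℝ} (hs : 0 ≤ s)
    {K : Set X} (hKc : IsClosed K) (hKx : Convex ℝ K)
    (h : ∀ b > s, ∃ t ∈ Set.Ioo s b, T t f ∈ K) : T s f ∈ K := by
  have hpos (n : ℕ) : s < s + 1 / ((n : ℝ) + 1) := by
    have : (0 : ℝ) < 1 / ((n : ℝ) + 1) := by positivity
    linarith
  choose t ht htK using fun n : ℕ => h _ (hpos n)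
  have h0 (n : ℕ) : 0 ≤ t n - s := by linarith [(ht n).1]
  have h1 (n : ℕ) : t n - s < 1 / ((n : ℝ) + 1) := by linarith [(ht n).2]
  refine hK (T s f) (fun n => t n - s) (fun n => ⟨h0 n, (h1 n).trans_le ?_⟩)
    (squeeze_zero h0 (fun n => (h1 n).le) tendsto_one_div_add_atTop_nhds_zero_nat) K hKc hKx
    fun n => ?_
  · rw [div_le_one (by positivity)]
    linarith [n.cast_nonneg (α := ℝ)]
  · rw [← ContinuousLinearMap.comp_apply, ← hT _ _ (h0 n) hs, sub_add_cancel]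
    exact htK n

theorem isSeparable_orbit (hK : ConvexRightContinuous T)
    (hT : ∀ s t : ℝ, 0 ≤ s → 0 ≤ t → T (s + t) = (T s).comp (T t)) (f : X) :
    TopologicalSpace.IsSeparable ((fun s => T s f) '' Set.Ici 0) := by
  have hsep : TopologicalSpace.IsSeparable
      (closure (Submodule.span ℝ (Set.range fun q : ℚ => T q f) : Set X)) :=
    ((Set.countable_range _).isSeparable.span).closure
  refine hsep.mono ?_
  rintro _ ⟨s, hs, rfl⟩
  refine hK.mem_of_frequently hT f hs isClosed_closure (Submodule.convex _).closure fun b hb => ?_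
  obtain ⟨q, hq⟩ := exists_rat_btwn hb
  exact ⟨q, hq, subset_closure (Submodule.subset_span ⟨q, rfl⟩)⟩

theorem exists_small_oscillation (hK : ConvexRightContinuous T)
    (hT : ∀ s t : ℝ, 0 ≤ s → 0 ≤ t → T (s + t) = (T s).comp (T t)) (f : X) {ε b : ℝ} (hε : 0 < ε)
    (hb : 0 < b) :
    ∃ s ∈ Set.Ioo 0 b, ∃ δ > 0, ∀ t ∈ Set.Ioo 0 δ, ‖T t (T s f) - T s f‖ ≤ ε := by
  obtain ⟨D, hDc, hD⟩ := hK.isSeparable_orbit hT f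
  let A : X → Set ℝ := fun d => {s ∈ Set.Ioo 0 b | T s f ∈ Metric.closedBall d (ε / 2)}
  have hcov : ∀ s, 0 ≤ s → ∃ d ∈ D, T s f ∈ Metric.closedBall d (ε / 2) := fun s hs => by
    obtain ⟨d, hd, hdist⟩ := Metric.mem_closure_iff.1 (hD ⟨s, hs, rfl⟩) (ε / 2) (by positivity)
    exact ⟨d, hd, Metric.mem_closedBall.2 hdist.le⟩
  have hdense := dense_biUnion_interior_of_closed (S := D)
    (f := fun d => closure (A d) ∪ (Set.Ioo 0 b)ᶜ)
    (fun d _ => isClosed_closure.union isOpen_Ioo.isClosed_compl) hDc (by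
      refine Set.eq_univ_of_forall fun s => ?_
      by_cases hs : s ∈ Set.Ioo 0 b
      · obtain ⟨d, hd, hds⟩ := hcov s hs.1.le
        exact Set.mem_biUnion hd (Or.inl (subset_closure ⟨hs, hds⟩))
      · obtain ⟨d, hd, -⟩ := hcov 0 le_rfl
        exact Set.mem_biUnion hd (Or.inr hs))
  obtain ⟨s, hsI, hs⟩ := hdense.inter_open_nonempty (Set.Ioo 0 b) isOpen_Ioo
    (Set.nonempty_Ioo.2 hb)
  obtain ⟨d, -, hsd⟩ := Set.mem_iUnion₂.1 hs
  obtain ⟨δ, hδ, hball⟩ := Metric.isOpen_iff.1 (isOpen_interior.inter isOpen_Ioo) s ⟨hsd, hsI⟩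
  rw [Real.ball_eq_Ioo] at hball
  have hcl : ∀ t ∈ Set.Ioo (s - δ) (s + δ), t ∈ closure (A d) := fun t ht =>
    (interior_subset (hball ht).1).resolve_right fun h => h (hball ht).2
  have hmem : ∀ t ∈ Set.Ioo (s - δ) (s + δ), T t f ∈ Metric.closedBall d (ε / 2) := fun t ht => by
    refine hK.mem_of_frequently hT f (hball ht).2.1.le Metric.isClosed_closedBall
      (convex_closedBall _ _) fun c hc => ?_
    obtain ⟨r, hr⟩ := exists_between (lt_min hc ht.2)
    obtain ⟨q, hq, hqA⟩ := mem_closure_iff.1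
      (hcl r ⟨ht.1.trans hr.1, hr.2.trans_le (min_le_right _ _)⟩) (Set.Ioo t (min c (s + δ)))
      isOpen_Ioo hr
    exact ⟨q, ⟨hq.1, hq.2.trans_le (min_le_left _ _)⟩, hqA.2⟩
  refine ⟨s, hsI, δ, hδ, fun t ht => ?_⟩
  rw [← ContinuousLinearMap.comp_apply, ← hT _ _ ht.1.le hsI.1.le, ← dist_eq_norm]
  have h1 := Metric.mem_closedBall.1 (hmem (t + s) ⟨by linarith [ht.1], by linarith [ht.2]⟩)
  have h2 := Metric.mem_closedBall.1 (hmem s ⟨by linarith, by linarith⟩)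
  linarith [dist_triangle_right (T (t + s) f) (T s f) d]

theorem convex_setOf_eventually_norm_sub_le (T : ℝ → X →L[ℝ] X) (ε : ℝ) (l : Filter ℝ) :
    Convex ℝ {g : X | ∀ᶠ t in l, ‖T t g - g‖ ≤ ε} := by
  intro x hx y hy a b ha hb hab
  filter_upwards [hx, hy] with t h1 h2
  have h : T t (a • x + b • y) - (a • x + b • y) = a • (T t x - x) + b • (T t y - y) := by
    simp only [map_add, map_smul]
    module
  rw [h]
  calc _ ≤ a * ‖T t x - x‖ + b * ‖T t y - y‖ := by
        refine (norm_add_le _ _).trans_eq ?_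
        rw [norm_smul, norm_smul, Real.norm_of_nonneg ha, Real.norm_of_nonneg hb]
    _ ≤ a * ε + b * ε := by gcongr
    _ = ε := by rw [← add_mul, hab, one_mul]

theorem tendsto (hK : ConvexRightContinuous T)
    (hT : ∀ s t : ℝ, 0 ≤ s → 0 ≤ t → T (s + t) = (T s).comp (T t)) {M : ℝ}
    (hM : ∀ t ∈ Set.Ico (0 : ℝ) 1, ‖T t‖ ≤ M) (f : X) :
    Tendsto (fun t => T t f) (𝓝[>] (0 : ℝ)) (𝓝 f) := by
  have hM0 : 0 ≤ M := (norm_nonneg _).trans (hM 0 (by simp))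
  have hcl : ∀ ε > 0, f ∈ closure {g : X | ∀ᶠ t in 𝓝[>] (0 : ℝ), ‖T t g - g‖ ≤ ε} := by
    intro ε hε
    have hpos (n : ℕ) : (0 : ℝ) < 1 / ((n : ℝ) + 1) := by positivity
    choose s hs δ hδ h using fun n : ℕ => hK.exists_small_oscillation hT f hε (hpos n)
    refine hK f s (fun n => ⟨(hs n).1.le, (hs n).2.trans_le ?_⟩)
      (squeeze_zero (fun n => (hs n).1.le) (fun n => (hs n).2.le)
        tendsto_one_div_add_atTop_nhds_zero_nat) _ isClosed_closure
      (convex_setOf_eventually_norm_sub_le T ε _).closure fun n => subset_closure ?_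
    · rw [div_le_one (by positivity)]
      linarith [n.cast_nonneg (α := ℝ)]
    · filter_upwards [Ioo_mem_nhdsGT (hδ n)] with t ht using h n t ht
  rw [Metric.tendsto_nhds]
  intro ε hε
  obtain ⟨g, hg, hfg⟩ := Metric.mem_closure_iff.1 (hcl (ε / 2) (by positivity))
    (ε / (2 * (M + 1))) (by positivity)
  filter_upwards [hg, Ioo_mem_nhdsGT one_pos] with t htg ht
  have h1 : ‖T t (f - g)‖ ≤ M * ‖f - g‖ :=
    (T t).le_of_opNorm_le (hM t ⟨ht.1.le, ht.2⟩) _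
  rw [dist_eq_norm, lt_div_iff₀ (by positivity)] at hfg
  rw [dist_eq_norm]
  calc ‖T t f - f‖ = ‖T t (f - g) + (T t g - g) - (f - g)‖ := by
        congr 1
        rw [map_sub]
        abel
    _ ≤ ‖T t (f - g)‖ + ‖T t g - g‖ + ‖f - g‖ :=
        (norm_sub_le _ _).trans (add_le_add_left (norm_add_le _ _) _)
    _ < ε := by linarith

end ConvexRightContinuous

end ConvexHull

section Lp

variable {Ω E : Type*} [MeasurableSpace Ω] {μ : Measure Ω} [NormedAddCommGroup E] {p : ℝ≥0∞}

theorem tendsto_eLpNorm_min_norm (hp0 : p ≠ 0) (hp : p ≠ ⊤) {G : Ω → E} {h : ℕ → Ω → E}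
    (hG : MemLp G p μ) (hh : ∀ n, AEStronglyMeasurable (h n) μ)
    (hlim : ∀ᵐ x ∂μ, Tendsto (fun n => h n x) atTop (𝓝 0)) :
    Tendsto (fun n => eLpNorm (fun x => min ‖G x‖ ‖h n x‖) p μ) atTop (𝓝 0) := by
  have hpos : 0 < p.toReal := ENNReal.toReal_pos hp0 hp
  have key : Tendsto (fun n => ∫⁻ x, ‖min ‖G x‖ ‖h n x‖‖ₑ ^ p.toReal ∂μ) atTop
      (𝓝 (∫⁻ _, 0 ∂μ)) := by
    refine tendsto_lintegral_of_dominated_convergence' (fun x => ‖G x‖ₑ ^ p.toReal)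
      (fun n => ?_) (fun n => ?_) ?_ ?_
    · exact ((hG.1.norm.inf (hh n).norm).enorm).pow_const _
    · refine Eventually.of_forall fun x => ?_
      refine ENNReal.rpow_le_rpow ?_ hpos.le
      rw [← enorm_norm (G x), Real.enorm_of_nonneg (by positivity),
        Real.enorm_of_nonneg (norm_nonneg _)]
      exact ENNReal.ofReal_le_ofReal (min_le_left _ _)
    · exact (lintegral_rpow_enorm_lt_top_of_eLpNorm_lt_top hp0 hp hG.2).ne
    · filter_upwards [hlim] with x hx
      have h1 : Tendsto (fun n => min ‖G x‖ ‖h n x‖) atTop (𝓝 0) := by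
        simpa using (tendsto_const_nhds (x := ‖G x‖)).min hx.norm
      have h2 := h1.enorm.ennrpow_const p.toReal
      simpa [hpos] using h2
  simp only [eLpNorm_eq_lintegral_rpow_enorm_toReal hp0 hp]
  have := key.ennrpow_const (1 / p.toReal)
  simpa [hpos] using this

theorem eLpNorm_max_norm_rpow_le (hp0 : p ≠ 0) (hp : p ≠ ⊤) {G h : Ω → E}
    (hG : AEStronglyMeasurable G μ) :
    eLpNorm (fun x => max ‖G x‖ ‖h x‖) p μ ^ p.toReal ≤
      eLpNorm G p μ ^ p.toReal + eLpNorm h p μ ^ p.toReal := by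
  have hpos : 0 < p.toReal := ENNReal.toReal_pos hp0 hp
  simp only [eLpNorm_eq_lintegral_rpow_enorm_toReal hp0 hp, ← ENNReal.rpow_mul,
    one_div_mul_cancel hpos.ne', ENNReal.rpow_one]
  rw [← lintegral_add_left' (hG.enorm.pow_const _)]
  refine lintegral_mono fun x => ?_
  rcases max_choice ‖G x‖ ‖h x‖ with hx | hx <;> simp [hx]

variable [Fact (1 ≤ p)]

theorem Lp.norm_add_le_rpow_add_eLpNorm_min (hp : p ≠ ⊤) (G h : Lp E p μ) :
    ‖G + h‖ ≤ (‖G‖ ^ p.toReal + ‖h‖ ^ p.toReal) ^ (1 / p.toReal) +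
      (eLpNorm (fun x => min ‖G x‖ ‖h x‖) p μ).toReal := by
  have h1 : 1 ≤ p := Fact.out
  have hp0 : p ≠ 0 := (zero_lt_one.trans_le h1).ne'
  have hpos : 0 < p.toReal := ENNReal.toReal_pos hp0 hp
  have hGm := Lp.memLp G
  have hhm := Lp.memLp h
  have hmax : MemLp (fun x => max ‖G x‖ ‖h x‖) p μ := hGm.norm.sup hhm.norm
  have hmin : MemLp (fun x => min ‖G x‖ ‖h x‖) p μ := hGm.norm.inf hhm.norm
  have hle : ‖G + h‖ ≤ (eLpNorm (fun x => max ‖G x‖ ‖h x‖) p μ).toReal +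
      (eLpNorm (fun x => min ‖G x‖ ‖h x‖) p μ).toReal := by
    rw [Lp.norm_def, ← ENNReal.toReal_add hmax.2.ne hmin.2.ne]
    refine ENNReal.toReal_mono (ENNReal.add_lt_top.2 ⟨hmax.2, hmin.2⟩).ne ?_
    refine le_trans ?_ (eLpNorm_add_le hmax.1 hmin.1 h1)
    refine eLpNorm_mono_ae_real ?_
    filter_upwards [Lp.coeFn_add G h] with x hx
    rw [hx]
    simpa [max_add_min] using norm_add_le (G x) (h x)
  refine hle.trans (add_le_add_left ?_ _)
  rw [one_div, Real.le_rpow_inv_iff_of_pos ENNReal.toReal_nonneg (by positivity) hpos,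
    Lp.norm_def, Lp.norm_def, ENNReal.toReal_rpow, ENNReal.toReal_rpow, ENNReal.toReal_rpow,
    ← ENNReal.toReal_add (ENNReal.rpow_ne_top_of_nonneg hpos.le hGm.2.ne)
      (ENNReal.rpow_ne_top_of_nonneg hpos.le hhm.2.ne)]
  refine ENNReal.toReal_mono ?_ (eLpNorm_max_norm_rpow_le hp0 hp hGm.1)
  exact (ENNReal.add_lt_top.2 ⟨ENNReal.rpow_lt_top_of_nonneg hpos.le hGm.2.ne,
    ENNReal.rpow_lt_top_of_nonneg hpos.le hhm.2.ne⟩).ne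

/-- A weak form of the Brezis–Lieb lemma. -/
theorem Lp.exists_norm_add_rpow_le (hp : p ≠ ⊤) (G : Lp E p μ) (h : ℕ → Lp E p μ) {M : ℝ}
    (hM : ∀ n, ‖h n‖ ≤ M) (hlim : ∀ᵐ x ∂μ, Tendsto (fun n => h n x) atTop (𝓝 0)) :
    ∃ n, ‖G + h n‖ ^ p.toReal ≤ ‖G‖ ^ p.toReal + (M ^ p.toReal + 1) := by
  have h1 : 1 ≤ p := Fact.out
  have hp0 : p ≠ 0 := (zero_lt_one.trans_le h1).ne'
  have hpos : 0 < p.toReal := ENNReal.toReal_pos hp0 hp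
  have hM0 : 0 ≤ M := (norm_nonneg _).trans (hM 0)
  set A := ‖G‖ ^ p.toReal + M ^ p.toReal with hA
  have hA0 : 0 ≤ A := by positivity
  have hmin := (ENNReal.tendsto_toReal ENNReal.zero_ne_top).comp
    (tendsto_eLpNorm_min_norm hp0 hp (Lp.memLp G) (fun n => (Lp.memLp (h n)).1) hlim)
  have hup : Tendsto (fun n => (A ^ (1 / p.toReal) +
      (eLpNorm (fun x => min ‖G x‖ ‖h n x‖) p μ).toReal) ^ p.toReal) atTop (𝓝 A) := by
    have := (hmin.const_add (A ^ (1 / p.toReal))).rpow_const (p := p.toReal) (Or.inr hpos.le)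
    simpa [Function.comp_def, ← Real.rpow_mul hA0, hpos.ne'] using this
  obtain ⟨n, hn⟩ := (hup.eventually_lt_const (lt_add_one A)).exists
  refine ⟨n, ?_⟩
  rw [← add_assoc, ← hA]
  refine le_trans ?_ hn.le
  refine Real.rpow_le_rpow (norm_nonneg _) ?_ hpos.le
  refine (Lp.norm_add_le_rpow_add_eLpNorm_min hp G (h n)).trans (add_le_add_left ?_ _)
  have := Real.rpow_le_rpow (norm_nonneg _) (hM n) hpos.le
  exact Real.rpow_le_rpow (by positivity) (by linarith) (by positivity)

/-- A Banach–Saks type property of bounded almost everywhere convergent sequences in `L^p`,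
`1 < p < ∞`. -/
theorem Lp.mem_of_isClosed_of_convex_of_tendsto_ae [NormedSpace ℝ E] (hp1 : 1 < p) (hp : p ≠ ⊤)
    (u : ℕ → Lp E p μ) (g : Lp E p μ) {M : ℝ} (hM : ∀ n, ‖u n‖ ≤ M)
    (hlim : ∀ᵐ x ∂μ, Tendsto (fun n => u n x) atTop (𝓝 (g x)))
    {K : Set (Lp E p μ)} (hKc : IsClosed K) (hKx : Convex ℝ K) (hK : ∀ n, u n ∈ K) : g ∈ K := by
  set r := p.toReal with hr
  have hr1 : 1 < r := by
    have := (ENNReal.toReal_lt_toReal ENNReal.one_ne_top hp).2 hp1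
    simpa using this
  have hr0 : 0 < r := by linarith
  have hlim0 : ∀ᵐ x ∂μ, Tendsto (fun n => (u n - g) x) atTop (𝓝 0) := by
    filter_upwards [hlim, ae_all_iff.2 fun n => Lp.coeFn_sub (u n) g] with x hx hsub
    simp only [hsub, Pi.sub_apply]
    simpa using hx.sub_const (g x)
  have hb : ∀ n, ‖u n - g‖ ≤ M + ‖g‖ := fun n =>
    (norm_sub_le _ _).trans (add_le_add_left (hM n) _)
  set C := (M + ‖g‖) ^ r + 1 with hC
  have hM0 : 0 ≤ M := (norm_nonneg _).trans (hM 0)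
  have hsum : ∀ N : ℕ, ∃ y ∈ K, ‖((N : ℝ) + 1) • (y - g)‖ ^ r ≤ ((N : ℝ) + 1) * C := by
    intro N
    induction N with
    | zero =>
      refine ⟨u 0, hK 0, ?_⟩
      have := Real.rpow_le_rpow (norm_nonneg _) (hb 0) hr0.le
      simp only [Nat.cast_zero, zero_add, one_smul, one_mul]
      linarith
    | succ N ih =>
      obtain ⟨y, hy, hyn⟩ := ih
      obtain ⟨n, hn⟩ := Lp.exists_norm_add_rpow_le hp (((N : ℝ) + 1) • (y - g)) _ hb hlim0
      have hN : (0 : ℝ) < (N : ℝ) + 1 + 1 := by positivity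
      refine ⟨(((N : ℝ) + 1) / (N + 1 + 1)) • y + (1 / ((N : ℝ) + 1 + 1)) • u n,
        hKx hy (hK n) (by positivity) (by positivity) (by field_simp), ?_⟩
      have heq : (((N + 1 : ℕ) : ℝ) + 1) • ((((N : ℝ) + 1) / (N + 1 + 1)) • y +
          (1 / ((N : ℝ) + 1 + 1)) • u n - g) = ((N : ℝ) + 1) • (y - g) + (u n - g) := by
        push_cast
        rw [smul_sub, smul_add, smul_smul, smul_smul, mul_div_cancel₀ _ hN.ne',
          mul_div_cancel₀ _ hN.ne']
        module
      rw [heq]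
      push_cast
      linarith
  rw [← hKc.closure_eq, Metric.mem_closure_iff]
  intro ε hε
  have htop : Tendsto (fun N : ℕ => ε ^ r * ((N : ℝ) + 1) ^ (r - 1)) atTop atTop :=
    ((tendsto_rpow_atTop (by linarith : 0 < r - 1)).comp
      (tendsto_atTop_add_const_right _ 1 tendsto_natCast_atTop_atTop)).const_mul_atTop
      (Real.rpow_pos_of_pos hε r)
  obtain ⟨N, hN⟩ := (htop.eventually_gt_atTop C).exists
  obtain ⟨y, hy, hyn⟩ := hsum N
  refine ⟨y, hy, ?_⟩
  have hN0 : (0 : ℝ) < (N : ℝ) + 1 := by positivity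
  rw [dist_comm, dist_eq_norm]
  rw [norm_smul, Real.norm_of_nonneg hN0.le] at hyn
  refine lt_of_mul_lt_mul_left ?_ hN0.le
  refine (Real.rpow_lt_rpow_iff (by positivity) (by positivity) hr0).1 (hyn.trans_lt ?_)
  rw [Real.mul_rpow hN0.le hε.le]
  calc ((N : ℝ) + 1) * C < (N + 1) * (ε ^ r * ((N : ℝ) + 1) ^ (r - 1)) := by gcongr
    _ = ((N : ℝ) + 1) ^ r * ε ^ r := by
        rw [Real.rpow_sub_one hN0.ne']
        field_simp

end Lp

/-- Let `1 < p < ∞`, let `(Ω, Σ, μ)` be a measure space, and let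
`(T_t)_{t ≥ 0}` be an operator semigroup on `L^p(Ω, μ)`.  Assume that for every
`f ∈ L^p(Ω, μ)` and every sequence `t_n → 0⁺` one has `T_{t_n} f → f` μ-almost everywhere
on `Ω`.  Then `(T_t)` is strongly continuous on `L^p(Ω, μ)` if and only if
`sup_{0 ≤ t < 1} ‖T_t‖ < ∞`. -/
theorem stmt0
    {Ω : Type*} [MeasurableSpace Ω] (μ : Measure Ω)
    (p : ℝ≥0∞) (hp1 : 1 < p) (hp2 : p ≠ ⊤) [Fact (1 ≤ p)]
    (T : ℝ → Lp ℂ p μ →L[ℂ] Lp ℂ p μ)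
    (hT0 : T 0 = ContinuousLinearMap.id ℂ (Lp ℂ p μ))
    (hTsemi : ∀ s t : ℝ, 0 ≤ s → 0 ≤ t → T (s + t) = (T s).comp (T t))
    (hae : ∀ f : Lp ℂ p μ, ∀ u : ℕ → ℝ, (∀ n, 0 ≤ u n) → Tendsto u atTop (𝓝 0) →
      ∀ᵐ x ∂μ, Tendsto (fun n => (T (u n) f : Ω → ℂ) x) atTop (𝓝 ((f : Ω → ℂ) x))) :
    (∀ f : Lp ℂ p μ, Tendsto (fun t => T t f) (𝓝[>] (0:ℝ)) (𝓝 f)) ↔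
      ∃ M : ℝ, ∀ t ∈ Set.Ico (0:ℝ) 1, ‖T t‖ ≤ M := by
  refine ⟨exists_norm_le_Ico_of_forall_tendsto T hT0 hTsemi, ?_⟩
  rintro ⟨M, hM⟩ f
  let S : ℝ → Lp ℂ p μ →L[ℝ] Lp ℂ p μ := fun t => (T t).restrictScalars ℝ
  have hS : ∀ s t : ℝ, 0 ≤ s → 0 ≤ t → S (s + t) = (S s).comp (S t) := fun s t hs ht => by
    ext1 g
    exact DFunLike.congr_fun (hTsemi s t hs ht) g
  have hSK : ConvexRightContinuous S := fun g u hu hu0 K hKc hKx hK =>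
    Lp.mem_of_isClosed_of_convex_of_tendsto_ae hp1 hp2 (fun n => T (u n) g) g
      (fun n => (T (u n)).le_of_opNorm_le (hM _ (hu n)) g)
      (hae g u (fun n => (hu n).1) hu0) hKc hKx hK
  exact hSK.tendsto hS (M := M)
    (fun t ht => (ContinuousLinearMap.norm_restrictScalars (T t)).trans_le (hM t ht)) f
end

section
/- Let 1 < p < ∞ and let (T_t)_{t≥0} be an operator semigroup on the Hardy space H^p. Assume that for every f ∈ H^p and every z ∈ 𝔻, T_t f(z) → f(z) as t → 0⁺. Then (T_t)_{t≥0} is strongly continuous on H^p if and only if sup_{0 ≤ t < 1} ‖T_t‖ < ∞. -/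
open Complex MeasureTheory Set Filter Metric Topology

/-- The `p`-th power integral mean of `f` over the circle of radius `r`,
`(2π)⁻¹ ∫_0^{2π} ‖f(r e^{iθ})‖^p dθ`. -/
noncomputable def hardyMeanP (p : ℝ) (f : ℂ → ℂ) (r : ℝ) : ℝ :=
  (2 * Real.pi)⁻¹ * ∫ θ in (0:ℝ)..(2 * Real.pi), ‖f ((r : ℂ) * Complex.exp ((θ : ℂ) * Complex.I))‖ ^ p

/-- The Hardy space norm `‖f‖_{H^p} = (sup_{0<r<1} (2π)⁻¹ ∫_0^{2π} ‖f(re^{iθ})‖^p dθ)^{1/p}`. -/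
noncomputable def hardyNorm (p : ℝ) (f : ℂ → ℂ) : ℝ :=
  (⨆ r : Set.Ioo (0:ℝ) 1, hardyMeanP p f (r : ℝ)) ^ (1 / p)

/-- Membership in the Hardy space `H^p`: `f` is analytic on the unit disk `𝔻` and its integral
means over circles are uniformly bounded. -/
def MemHardy (p : ℝ) (f : ℂ → ℂ) : Prop :=
  DifferentiableOn ℂ f (Metric.ball 0 1) ∧
    BddAbove (Set.range fun r : Set.Ioo (0:ℝ) 1 => hardyMeanP p f (r : ℝ))

theorem hardyMeanP_eq_circleAverage (p : ℝ) (f : ℂ → ℂ) (r : ℝ) :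
    hardyMeanP p f r = Real.circleAverage (fun z => ‖f z‖ ^ p) 0 r := by
  simp [hardyMeanP, Real.circleAverage, circleMap]

theorem rpow_add_tangent_le {p : ℝ} (hp : 1 < p) {a x : ℝ} (ha : 0 ≤ a) (hx : 0 ≤ x) :
    a ^ p + p * a ^ (p - 1) * (x - a) ≤ x ^ p := by
  rcases ha.eq_or_lt with rfl | ha
  · rw [Real.zero_rpow (by linarith), Real.zero_rpow (by linarith)]
    simpa using Real.rpow_nonneg hx p
  · have h := one_add_mul_self_le_rpow_one_add (s := x / a - 1) (p := p)
      (by have := div_nonneg hx ha.le; linarith) hp.le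
    have h1 : 1 + (x / a - 1) = x / a := by ring
    rw [h1, Real.div_rpow hx ha.le, le_div_iff₀ (Real.rpow_pos_of_pos ha p)] at h
    refine le_trans (le_of_eq ?_) h
    rw [Real.rpow_sub_one ha.ne']
    field_simp

section DiskFunctions

variable {f g : ℂ → ℂ} {p r R : ℝ}

theorem continuousOn_sphere_of_differentiableOn_ball (hf : DifferentiableOn ℂ f (ball 0 1))
    (hr : r ∈ Ioo (0 : ℝ) 1) : ContinuousOn f (sphere 0 |r|) := by
  refine hf.continuousOn.mono fun z hz => ?_
  rw [abs_of_pos hr.1, mem_sphere_zero_iff_norm] at hz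
  simpa [hz] using hr.2

theorem circleIntegrable_of_continuousOn_sphere {E : Type*} [NormedAddCommGroup E] {h : ℂ → E}
    (hh : ContinuousOn h (sphere 0 |r|)) : CircleIntegrable h 0 r :=
  (ContinuousOn.circleIntegrable' hh)

theorem continuousOn_norm_rpow (hp : 0 ≤ p) (hf : DifferentiableOn ℂ f (ball 0 1))
    (hr : r ∈ Ioo (0 : ℝ) 1) : ContinuousOn (fun z => ‖f z‖ ^ p) (sphere 0 |r|) :=
  (continuousOn_sphere_of_differentiableOn_ball hf hr).norm.rpow_const fun _ _ => Or.inr hp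

theorem circleIntegrable_norm_rpow (hp : 0 ≤ p) (hf : DifferentiableOn ℂ f (ball 0 1))
    (hr : r ∈ Ioo (0 : ℝ) 1) : CircleIntegrable (fun z => ‖f z‖ ^ p) 0 r :=
  circleIntegrable_of_continuousOn_sphere (continuousOn_norm_rpow hp hf hr)

theorem diffContOnCl_of_differentiableOn_ball (hf : DifferentiableOn ℂ f (ball 0 1))
    (hr : r ∈ Ioo (0 : ℝ) 1) : DiffContOnCl ℂ f (ball 0 r) := by
  refine DifferentiableOn.diffContOnCl (hf.mono ?_)
  rw [closure_ball _ hr.1.ne']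
  exact closedBall_subset_ball hr.2

theorem hardyMeanP_nonneg : 0 ≤ hardyMeanP p f r := by
  rw [hardyMeanP_eq_circleAverage]
  exact Real.circleAverage_nonneg_of_nonneg fun x _ => by positivity

/-- The Poisson integral of `‖f‖ ^ p` dominates `‖f‖ ^ p` inside the circle. -/
theorem norm_rpow_le_circleAverage (hp : 1 < p) (hf : DifferentiableOn ℂ f (ball 0 1))
    (hR : R ∈ Ioo (0 : ℝ) 1) {w : ℂ} (hw : w ∈ ball 0 R) :
    ‖f w‖ ^ p ≤
      Real.circleAverage ((Complex.re ∘ herglotzRieszKernel 0 w) • fun z => ‖f z‖ ^ p) 0 R := by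
  set P : ℂ → ℝ := Complex.re ∘ herglotzRieszKernel 0 w with hP
  have hPc : ContinuousOn P (sphere 0 |R|) :=
    Complex.continuous_re.comp_continuousOn (continuousOn_herglotzRieszKernel_sphere hw)
  have hP0 : ∀ z ∈ sphere (0 : ℂ) |R|, 0 ≤ P z := by
    intro z hz
    rw [abs_of_pos hR.1] at hz
    refine le_trans ?_ (le_re_herglotzRieszKernel hz hw)
    have : ‖w‖ < R := by simpa using hw
    rw [sub_zero]
    exact div_nonneg (by linarith) (by linarith [norm_nonneg w])
  have hfc := continuousOn_sphere_of_differentiableOn_ball hf hR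
  have hrep : Real.circleAverage (P • f) 0 R = f w :=
    (diffContOnCl_of_differentiableOn_ball hf hR).circleAverage_re_herglotzRieszKernel_smul hw
  have hone : Real.circleAverage P 0 R = 1 := by
    have h := (diffContOnCl_const (𝕜 := ℂ) (s := ball (0 : ℂ) R)
      (c := (1 : ℂ))).circleAverage_re_herglotzRieszKernel_smul hw
    have h2 := Complex.reCLM.circleAverage_comp_comm (f := P • fun _ => (1 : ℂ)) (c := 0) (R := R)
      (circleIntegrable_of_continuousOn_sphere (hPc.smul continuousOn_const))
    rw [h] at h2
    simpa [Function.comp_def] using h2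
  have hle : ‖f w‖ ≤ Real.circleAverage (fun z => P z * ‖f z‖) 0 R := by
    rw [← hrep, Real.circleAverage, Real.circleAverage, norm_smul, smul_eq_mul,
      Real.norm_of_nonneg (by positivity)]
    gcongr
    refine (intervalIntegral.norm_integral_le_integral_norm Real.two_pi_pos.le).trans (le_of_eq ?_)
    refine intervalIntegral.integral_congr fun θ _ => ?_
    simp only [Pi.smul_apply', norm_smul]
    rw [Real.norm_of_nonneg (hP0 _ (circleMap_mem_sphere' 0 R θ))]
  set a := ‖f w‖ with ha
  have hi1 : CircleIntegrable P 0 R := circleIntegrable_of_continuousOn_sphere hPc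
  have hi2 : CircleIntegrable (fun z => P z * ‖f z‖) 0 R :=
    circleIntegrable_of_continuousOn_sphere (hPc.mul hfc.norm)
  have hkey : Real.circleAverage
      (fun z => (a ^ p - p * a ^ (p - 1) * a) • P z + (p * a ^ (p - 1)) • (P z * ‖f z‖)) 0 R ≤
      Real.circleAverage (P • fun z => ‖f z‖ ^ p) 0 R := by
    refine Real.circleAverage_mono ?_ ?_ ?_
    · exact circleIntegrable_of_continuousOn_sphere
        ((hPc.fun_const_smul _).fun_add ((hPc.fun_mul hfc.norm).fun_const_smul _))
    · exact circleIntegrable_of_continuousOn_sphere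
        (hPc.smul (continuousOn_norm_rpow (by linarith) hf hR))
    · intro z hz
      have h1 := mul_le_mul_of_nonneg_left
        (rpow_add_tangent_le hp (norm_nonneg (f w)) (norm_nonneg (f z))) (hP0 z hz)
      simp only [Pi.smul_apply', smul_eq_mul]
      refine le_trans (le_of_eq ?_) h1
      rw [← ha]; ring
  refine le_trans ?_ hkey
  rw [Real.circleAverage_fun_add (hi1.const_fun_smul) (hi2.const_fun_smul),
    Real.circleAverage_fun_smul, Real.circleAverage_fun_smul, hone]
  have h3 : 0 ≤ p * a ^ (p - 1) := by positivity
  have := mul_le_mul_of_nonneg_left hle h3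
  simp only [smul_eq_mul]
  linarith

/-- The integral means of an analytic function increase with the radius. -/
theorem hardyMeanP_mono (hp : 1 < p) (hf : DifferentiableOn ℂ f (ball 0 1))
    (hr : r ∈ Ioo (0 : ℝ) 1) (hR : R ∈ Ioo (0 : ℝ) 1) (hrR : r ≤ R) :
    hardyMeanP p f r ≤ hardyMeanP p f R := by
  rcases hrR.eq_or_lt with rfl | hrR
  · exact le_rfl
  rw [hardyMeanP_eq_circleAverage, hardyMeanP_eq_circleAverage]
  have hi := circleIntegrable_norm_rpow (by linarith : 0 ≤ p) hf hR
  have hi' : CircleIntegrable (fun z => ((‖f z‖ ^ p : ℝ) : ℂ)) 0 R :=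
    circleIntegrable_of_continuousOn_sphere
      (Complex.continuous_ofReal.comp_continuousOn (continuousOn_norm_rpow (by linarith) hf hR))
  set F : ℂ → ℂ := fun w =>
    Real.circleAverage (fun ζ => herglotzRieszKernel 0 w ζ • ((‖f ζ‖ ^ p : ℝ) : ℂ)) 0 R with hF
  have hFd : DifferentiableOn ℂ F (ball 0 R) :=
    differentiableOn_circleAverage_herglotzRieszKernel_smul hi'
  have hcl : closedBall (0 : ℂ) |r| ⊆ ball 0 R := by
    rw [abs_of_pos hr.1]; exact closedBall_subset_ball hrR
  have hFcl : DiffContOnCl ℂ F (ball 0 |r|) := by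
    refine DifferentiableOn.diffContOnCl (hFd.mono ?_)
    rwa [closure_ball _ (abs_pos.2 hr.1.ne').ne']
  have hFi : CircleIntegrable F 0 r := circleIntegrable_of_continuousOn_sphere
    (hFd.continuousOn.mono (sphere_subset_closedBall.trans hcl))
  have hmean : Real.circleAverage (Complex.reCLM ∘ F) 0 r = (F 0).re := by
    rw [Complex.reCLM.circleAverage_comp_comm hFi, hFcl.circleAverage]; rfl
  have hre : ∀ w ∈ ball (0 : ℂ) R, (F w).re = Real.circleAverage
      ((Complex.re ∘ herglotzRieszKernel 0 w) • fun z => ‖f z‖ ^ p) 0 R := fun w hw =>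
    re_circleAverage_herglotzRieszKernel_smul hi hw
  have h0 : (F 0).re = Real.circleAverage (fun z => ‖f z‖ ^ p) 0 R := by
    rw [hre 0 (by simpa using hR.1)]
    refine Real.circleAverage_congr_sphere fun z hz => ?_
    have hz0 : z ≠ 0 := by
      rintro rfl
      rw [abs_of_pos hR.1] at hz
      simp only [mem_sphere_iff_norm, sub_zero, norm_zero] at hz
      exact hR.1.ne hz
    simp [herglotzRieszKernel_def, hz0]
  rw [← h0, ← hmean]
  refine Real.circleAverage_mono (circleIntegrable_norm_rpow (by linarith) hf hr)
    (circleIntegrable_of_continuousOn_sphere (Complex.continuous_re.comp_continuousOn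
      (hFd.continuousOn.mono (sphere_subset_closedBall.trans hcl)))) fun z hz => ?_
  have hzR := hcl (sphere_subset_closedBall hz)
  simp only [Function.comp_apply, Complex.reCLM_apply]
  rw [hre z hzR]
  exact norm_rpow_le_circleAverage hp hf hR hzR

theorem norm_rpow_le_hardyMeanP (hp : 1 < p) (hf : DifferentiableOn ℂ f (ball 0 1))
    (hR : R ∈ Ioo (0 : ℝ) 1) {w : ℂ} (hw : w ∈ ball 0 R) :
    ‖f w‖ ^ p ≤ (R + ‖w‖) / (R - ‖w‖) * hardyMeanP p f R := by
  refine (norm_rpow_le_circleAverage hp hf hR hw).trans ?_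
  rw [hardyMeanP_eq_circleAverage, ← smul_eq_mul, ← Real.circleAverage_fun_smul]
  have hp0 : 0 ≤ p := by linarith
  have hc := continuousOn_norm_rpow hp0 hf hR
  refine Real.circleAverage_mono ?_ (circleIntegrable_of_continuousOn_sphere (hc.fun_const_smul _)) ?_
  · exact circleIntegrable_of_continuousOn_sphere ((Complex.continuous_re.comp_continuousOn
      (continuousOn_herglotzRieszKernel_sphere hw)).smul hc)
  · intro z hz
    rw [abs_of_pos hR.1] at hz
    have := re_herglotzRieszKernel_le hz hw
    rw [sub_zero] at this
    simp only [Pi.smul_apply', smul_eq_mul, Function.comp_apply, herglotzRieszKernel_def, sub_zero]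
    gcongr
    simpa using this

end DiskFunctions

theorem add_div_two_rpow_lt {p : ℝ} (hp : 1 < p) {z w : ℂ} (hzw : z ≠ w) :
    ‖(z + w) / 2‖ ^ p < (‖z‖ ^ p + ‖w‖ ^ p) / 2 := by
  have hp0 : 0 < p := by linarith
  have h2 : ‖(z + w) / 2‖ = ‖z + w‖ / 2 := by simp
  by_cases hn : ‖z‖ = ‖w‖
  · rw [← hn, add_self_div_two]
    refine Real.rpow_lt_rpow (norm_nonneg _) ?_ hp0
    have hray : ¬ SameRay ℝ z w := fun h => hzw ((sameRay_iff_of_norm_eq hn).1 h)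
    have := norm_add_lt_of_not_sameRay hray
    rw [h2]; linarith
  · have hs := (strictConvexOn_rpow hp).2 (mem_Ici.2 (norm_nonneg z)) (mem_Ici.2 (norm_nonneg w)) hn
      (by norm_num : (0 : ℝ) < 1 / 2) (by norm_num : (0 : ℝ) < 1 / 2) (by norm_num)
    simp only [smul_eq_mul] at hs
    have hle : ‖(z + w) / 2‖ ^ p ≤ (1 / 2 * ‖z‖ + 1 / 2 * ‖w‖) ^ p := by
      refine Real.rpow_le_rpow (norm_nonneg _) ?_ hp0.le
      have := norm_add_le z w
      rw [h2]; linarith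
    linarith

theorem add_div_two_rpow_le {p : ℝ} (hp : 1 < p) (z w : ℂ) :
    ‖(z + w) / 2‖ ^ p ≤ (‖z‖ ^ p + ‖w‖ ^ p) / 2 := by
  rcases eq_or_ne z w with rfl | h
  · simp
  · exact (add_div_two_rpow_lt hp h).le

/-- A quantitative form of uniform convexity for the power `‖·‖ ^ p`. -/
theorem exists_norm_sub_rpow_le {p : ℝ} (hp : 1 < p) {η : ℝ} (hη : 0 < η) :
    ∃ C : ℝ, 0 ≤ C ∧ ∀ z w : ℂ, ‖z - w‖ ^ p ≤ η * (‖z‖ ^ p + ‖w‖ ^ p) +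
      C * ((‖z‖ ^ p + ‖w‖ ^ p) / 2 - ‖(z + w) / 2‖ ^ p) := by
  have hp0 : 0 < p := by linarith
  set a : ℂ × ℂ → ℝ := fun x => ‖x.1 - x.2‖ ^ p - η * (‖x.1‖ ^ p + ‖x.2‖ ^ p) with ha
  set b : ℂ × ℂ → ℝ := fun x => (‖x.1‖ ^ p + ‖x.2‖ ^ p) / 2 - ‖(x.1 + x.2) / 2‖ ^ p with hb
  have hac : Continuous a := by
    have h (g : ℂ × ℂ → ℂ) (hg : Continuous g) : Continuous fun x => ‖g x‖ ^ p :=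
      hg.norm.rpow_const fun _ => Or.inr hp0.le
    exact (h _ (continuous_fst.sub continuous_snd)).sub
      (((h _ continuous_fst).add (h _ continuous_snd)).const_mul _)
  have hbc : Continuous b := by
    have h (g : ℂ × ℂ → ℂ) (hg : Continuous g) : Continuous fun x => ‖g x‖ ^ p :=
      hg.norm.rpow_const fun _ => Or.inr hp0.le
    exact (((h _ continuous_fst).add (h _ continuous_snd)).div_const _).sub
      (h _ ((continuous_fst.add continuous_snd).div_const _))
  have hb0 : ∀ x, 0 ≤ b x := fun x => sub_nonneg.2 (add_div_two_rpow_le hp x.1 x.2)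
  set K : Set (ℂ × ℂ) := sphere 0 1 ∩ {x | 0 ≤ a x} with hK
  have hKc : IsCompact K := (isCompact_sphere _ _).inter_right (isClosed_le continuous_const hac)
  have hbpos : ∀ x ∈ K, 0 < b x := by
    rintro ⟨z, w⟩ ⟨hx, hx'⟩
    refine sub_pos.2 (add_div_two_rpow_lt hp ?_)
    show z ≠ w
    rintro rfl
    have hz : ‖z‖ = 1 := by simpa using hx
    simp only [ha, mem_ofPred_eq, sub_self, norm_zero, Real.zero_rpow hp0.ne', hz,
      Real.one_rpow] at hx'
    linarith
  obtain ⟨C, hC0, hC⟩ : ∃ C : ℝ, 0 ≤ C ∧ ∀ x ∈ sphere (0 : ℂ × ℂ) 1, a x ≤ C * b x := by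
    rcases K.eq_empty_or_nonempty with hKe | hKn
    · refine ⟨0, le_rfl, fun x hx => ?_⟩
      by_contra! h
      rw [zero_mul] at h
      exact (hKe ▸ (⟨hx, h.le⟩ : x ∈ K) : x ∈ (∅ : Set (ℂ × ℂ)))
    · obtain ⟨x₀, hx₀, hmax⟩ := hKc.exists_isMaxOn hKn
        (hac.continuousOn.div hbc.continuousOn fun x hx => (hbpos x hx).ne')
      refine ⟨a x₀ / b x₀, div_nonneg hx₀.2 (hb0 _), fun x hx => ?_⟩
      by_cases hax : 0 ≤ a x
      · exact (div_le_iff₀ (hbpos x ⟨hx, hax⟩)).1 (hmax ⟨hx, hax⟩)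
      · exact (not_le.1 hax).le.trans (mul_nonneg (div_nonneg hx₀.2 (hb0 _)) (hb0 _))
  refine ⟨C, hC0, fun z w => ?_⟩
  rcases eq_or_ne ((z, w) : ℂ × ℂ) 0 with h0 | h0
  · simp only [Prod.mk_eq_zero] at h0
    simp [h0, Real.zero_rpow hp0.ne']
  set t := ‖((z, w) : ℂ × ℂ)‖ with ht
  have htpos : 0 < t := norm_pos_iff.2 h0
  have hx : ((t : ℂ)⁻¹ * z, (t : ℂ)⁻¹ * w) ∈ sphere (0 : ℂ × ℂ) 1 := by
    have : ((t : ℂ)⁻¹ * z, (t : ℂ)⁻¹ * w) = (t : ℂ)⁻¹ • ((z, w) : ℂ × ℂ) := rfl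
    rw [mem_sphere_zero_iff_norm, this, norm_smul, ← ht, norm_inv, Complex.norm_real,
      Real.norm_of_nonneg htpos.le, inv_mul_cancel₀ htpos.ne']
  have hscale (u : ℂ) : ‖(t : ℂ)⁻¹ * u‖ ^ p = (t ^ p)⁻¹ * ‖u‖ ^ p := by
    rw [norm_mul, norm_inv, Complex.norm_real, Real.norm_of_nonneg htpos.le,
      Real.mul_rpow (by positivity) (norm_nonneg _), Real.inv_rpow htpos.le]
  have h := hC _ hx
  simp only [ha, hb] at h
  rw [← mul_sub, ← mul_add, mul_div_assoc, hscale, hscale, hscale, hscale] at h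
  have htp : 0 < t ^ p := Real.rpow_pos_of_pos htpos p
  have h' := mul_le_mul_of_nonneg_left h htp.le
  have e (u : ℝ) : t ^ p * ((t ^ p)⁻¹ * u) = u := by field_simp
  have e1 : t ^ p * ((t ^ p)⁻¹ * ‖z - w‖ ^ p - η * ((t ^ p)⁻¹ * ‖z‖ ^ p + (t ^ p)⁻¹ * ‖w‖ ^ p)) =
      ‖z - w‖ ^ p - η * (‖z‖ ^ p + ‖w‖ ^ p) := by field_simp
  have e2 : t ^ p * (C * (((t ^ p)⁻¹ * ‖z‖ ^ p + (t ^ p)⁻¹ * ‖w‖ ^ p) / 2 -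
      (t ^ p)⁻¹ * ‖(z + w) / 2‖ ^ p)) = C * ((‖z‖ ^ p + ‖w‖ ^ p) / 2 - ‖(z + w) / 2‖ ^ p) := by
    field_simp
  rw [e1, e2] at h'
  linarith

theorem norm_add_rpow_le {p : ℝ} (hp : 1 < p) {a b : ℝ} (ha : 0 < a) (hb : 0 < b) (z w : ℂ) :
    ‖z + w‖ ^ p ≤ (a + b) ^ p * (a / (a + b) * (‖z‖ ^ p / a ^ p) +
      b / (a + b) * (‖w‖ ^ p / b ^ p)) := by
  have hab : 0 < a + b := by positivity
  have h := (convexOn_rpow hp.le).2 (mem_Ici.2 (by positivity : 0 ≤ ‖z‖ / a))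
    (mem_Ici.2 (by positivity : 0 ≤ ‖w‖ / b))
    (by positivity : 0 ≤ a / (a + b)) (by positivity : 0 ≤ b / (a + b)) (by field_simp)
  simp only [smul_eq_mul] at h
  rw [← Real.div_rpow (norm_nonneg _) ha.le, ← Real.div_rpow (norm_nonneg _) hb.le]
  refine le_trans ?_ (mul_le_mul_of_nonneg_left h (by positivity))
  rw [← Real.mul_rpow hab.le (by positivity)]
  refine Real.rpow_le_rpow (norm_nonneg _) ((norm_add_le z w).trans (le_of_eq ?_)) (by linarith)
  field_simp

section HardyMeans

variable {f g : ℂ → ℂ} {p r : ℝ}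

theorem hardyMeanP_congr (hr : r ∈ Ioo (0 : ℝ) 1) (h : EqOn f g (ball 0 1)) :
    hardyMeanP p f r = hardyMeanP p g r := by
  rw [hardyMeanP_eq_circleAverage, hardyMeanP_eq_circleAverage]
  refine Real.circleAverage_congr_sphere fun z hz => ?_
  rw [abs_of_pos hr.1, mem_sphere_zero_iff_norm] at hz
  rw [h (by simpa [hz] using hr.2)]

theorem hardyMeanP_smul (c : ℂ) :
    hardyMeanP p (c • f) r = ‖c‖ ^ p * hardyMeanP p f r := by
  rw [hardyMeanP_eq_circleAverage, hardyMeanP_eq_circleAverage, ← smul_eq_mul,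
    ← Real.circleAverage_fun_smul]
  congr 1
  ext z
  simp [Real.mul_rpow]

theorem hardyMeanP_add_le (hp : 1 < p) (hf : DifferentiableOn ℂ f (ball 0 1))
    (hg : DifferentiableOn ℂ g (ball 0 1)) (hr : r ∈ Ioo (0 : ℝ) 1) {a b : ℝ} (ha : 0 < a)
    (hb : 0 < b) (hfa : hardyMeanP p f r ≤ a ^ p) (hgb : hardyMeanP p g r ≤ b ^ p) :
    hardyMeanP p (f + g) r ≤ (a + b) ^ p := by
  have hp0 : 0 ≤ p := by linarith
  have hcf := circleIntegrable_norm_rpow hp0 hf hr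
  have hcg := circleIntegrable_norm_rpow hp0 hg hr
  have h1 : hardyMeanP p (f + g) r ≤ Real.circleAverage (fun z =>
      ((a + b) ^ p * (a / (a + b)) / a ^ p) • ‖f z‖ ^ p +
        ((a + b) ^ p * (b / (a + b)) / b ^ p) • ‖g z‖ ^ p) 0 r := by
    rw [hardyMeanP_eq_circleAverage]
    refine Real.circleAverage_mono (circleIntegrable_norm_rpow hp0 (hf.add hg) hr)
      (hcf.const_fun_smul.add hcg.const_fun_smul) fun z _ => ?_
    refine (norm_add_rpow_le hp ha hb (f z) (g z)).trans (le_of_eq ?_)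
    simp only [smul_eq_mul]
    ring
  rw [Real.circleAverage_fun_add hcf.const_fun_smul hcg.const_fun_smul,
    Real.circleAverage_fun_smul, Real.circleAverage_fun_smul, ← hardyMeanP_eq_circleAverage,
    ← hardyMeanP_eq_circleAverage, smul_eq_mul, smul_eq_mul] at h1
  have h2 := mul_le_mul_of_nonneg_left hfa
    (by positivity : 0 ≤ (a + b) ^ p * (a / (a + b)) / a ^ p)
  have h3 := mul_le_mul_of_nonneg_left hgb
    (by positivity : 0 ≤ (a + b) ^ p * (b / (a + b)) / b ^ p)
  have h4 : (a + b) ^ p * (a / (a + b)) / a ^ p * a ^ p +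
      (a + b) ^ p * (b / (a + b)) / b ^ p * b ^ p = (a + b) ^ p := by
    have := (Real.rpow_pos_of_pos ha p).ne'
    have := (Real.rpow_pos_of_pos hb p).ne'
    field_simp
  linarith

theorem hardyMeanP_sub_le {η C : ℝ} (hp : 1 < p)
    (hC : ∀ z w : ℂ, ‖z - w‖ ^ p ≤ η * (‖z‖ ^ p + ‖w‖ ^ p) +
      C * ((‖z‖ ^ p + ‖w‖ ^ p) / 2 - ‖(z + w) / 2‖ ^ p))
    (hf : DifferentiableOn ℂ f (ball 0 1)) (hg : DifferentiableOn ℂ g (ball 0 1))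
    (hr : r ∈ Ioo (0 : ℝ) 1) :
    hardyMeanP p (f - g) r ≤ η * (hardyMeanP p f r + hardyMeanP p g r) +
      C * ((hardyMeanP p f r + hardyMeanP p g r) / 2 -
        hardyMeanP p ((2⁻¹ : ℂ) • (f + g)) r) := by
  have hp0 : 0 ≤ p := by linarith
  have hcf := circleIntegrable_norm_rpow hp0 hf hr
  have hcg := circleIntegrable_norm_rpow hp0 hg hr
  have hcm := circleIntegrable_norm_rpow hp0 ((hf.add hg).const_smul (2⁻¹ : ℂ)) hr
  have hcfg : CircleIntegrable
      (fun z => (η + C / 2) • ‖f z‖ ^ p + (η + C / 2) • ‖g z‖ ^ p) 0 r :=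
    hcf.const_fun_smul.add hcg.const_fun_smul
  have h1 : hardyMeanP p (f - g) r ≤ Real.circleAverage (fun z =>
      ((η + C / 2) • ‖f z‖ ^ p + (η + C / 2) • ‖g z‖ ^ p) +
        (-C) • ‖((2⁻¹ : ℂ) • (f + g)) z‖ ^ p) 0 r := by
    rw [hardyMeanP_eq_circleAverage]
    refine Real.circleAverage_mono (circleIntegrable_norm_rpow hp0 (hf.sub hg) hr)
      (hcfg.add hcm.const_fun_smul) fun z _ => ?_
    refine (hC (f z) (g z)).trans (le_of_eq ?_)
    simp only [Pi.smul_apply, Pi.add_apply, smul_eq_mul]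
    rw [div_eq_inv_mul (f z + g z)]
    ring
  rw [Real.circleAverage_fun_add hcfg hcm.const_fun_smul,
    Real.circleAverage_fun_add hcf.const_fun_smul hcg.const_fun_smul,
    Real.circleAverage_fun_smul, Real.circleAverage_fun_smul, Real.circleAverage_fun_smul,
    ← hardyMeanP_eq_circleAverage, ← hardyMeanP_eq_circleAverage,
    ← hardyMeanP_eq_circleAverage, smul_eq_mul, smul_eq_mul, smul_eq_mul] at h1
  linarith

end HardyMeans

section HardyNorm

variable {f g : ℂ → ℂ} {p : ℝ}

instance : Nonempty (Ioo (0 : ℝ) 1) := ⟨⟨1 / 2, by norm_num, by norm_num⟩⟩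

theorem iSup_hardyMeanP_nonneg : 0 ≤ ⨆ r : Ioo (0 : ℝ) 1, hardyMeanP p f r :=
  Real.iSup_nonneg fun _ => hardyMeanP_nonneg

theorem hardyNorm_nonneg : 0 ≤ hardyNorm p f := Real.rpow_nonneg iSup_hardyMeanP_nonneg _

theorem hardyNorm_rpow (hp : 0 < p) :
    hardyNorm p f ^ p = ⨆ r : Ioo (0 : ℝ) 1, hardyMeanP p f r := by
  rw [hardyNorm, one_div, Real.rpow_inv_rpow iSup_hardyMeanP_nonneg hp.ne']

theorem hardyNorm_congr (h : EqOn f g (ball 0 1)) : hardyNorm p f = hardyNorm p g := by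
  rw [hardyNorm, hardyNorm]
  congr 1
  exact iSup_congr fun r => hardyMeanP_congr r.2 h

theorem MemHardy.congr (hf : MemHardy p f) (h : EqOn f g (ball 0 1)) : MemHardy p g := by
  refine ⟨hf.1.congr fun z hz => (h hz).symm, ?_⟩
  convert hf.2 using 3 with r
  exact (hardyMeanP_congr r.2 h).symm

theorem hardyMeanP_le_hardyNorm_rpow (hp : 0 < p) (hf : MemHardy p f) {r : ℝ}
    (hr : r ∈ Ioo (0 : ℝ) 1) : hardyMeanP p f r ≤ hardyNorm p f ^ p := by
  rw [hardyNorm_rpow hp]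
  exact le_ciSup hf.2 (⟨r, hr⟩ : Ioo (0 : ℝ) 1)

theorem hardyNorm_le (hp : 0 < p) {c : ℝ} (hc : 0 ≤ c)
    (h : ∀ r ∈ Ioo (0 : ℝ) 1, hardyMeanP p f r ≤ c ^ p) : hardyNorm p f ≤ c := by
  rw [← Real.rpow_le_rpow_iff hardyNorm_nonneg hc hp, hardyNorm_rpow hp]
  exact ciSup_le fun r => h r r.2

theorem MemHardy.of_le (hf : DifferentiableOn ℂ f (ball 0 1)) {c : ℝ}
    (h : ∀ r ∈ Ioo (0 : ℝ) 1, hardyMeanP p f r ≤ c) : MemHardy p f :=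
  ⟨hf, c, by rintro _ ⟨r, rfl⟩; exact h r r.2⟩

theorem hardyMeanP_add_le_of_memHardy (hp : 1 < p) (hf : MemHardy p f) (hg : MemHardy p g)
    {ε : ℝ} (hε : 0 < ε) {r : ℝ} (hr : r ∈ Ioo (0 : ℝ) 1) :
    hardyMeanP p (f + g) r ≤ ((hardyNorm p f + ε) + (hardyNorm p g + ε)) ^ p := by
  have hp0 : 0 < p := by linarith
  have hN (h : ℂ → ℂ) (hh : MemHardy p h) : hardyMeanP p h r ≤ (hardyNorm p h + ε) ^ p :=
    (hardyMeanP_le_hardyNorm_rpow hp0 hh hr).trans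
      (Real.rpow_le_rpow hardyNorm_nonneg (by linarith) hp0.le)
  exact hardyMeanP_add_le hp hf.1 hg.1 hr (add_pos_of_nonneg_of_pos hardyNorm_nonneg hε)
    (add_pos_of_nonneg_of_pos hardyNorm_nonneg hε) (hN f hf) (hN g hg)

theorem MemHardy.add (hp : 1 < p) (hf : MemHardy p f) (hg : MemHardy p g) :
    MemHardy p (f + g) :=
  MemHardy.of_le (hf.1.add hg.1) fun _ hr =>
    hardyMeanP_add_le_of_memHardy hp hf hg one_pos hr

theorem hardyNorm_add_le (hp : 1 < p) (hf : MemHardy p f) (hg : MemHardy p g) :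
    hardyNorm p (f + g) ≤ hardyNorm p f + hardyNorm p g := by
  refine le_of_forall_pos_le_add fun ε hε => ?_
  have h0 : 0 ≤ hardyNorm p f := hardyNorm_nonneg
  have h1 : 0 ≤ hardyNorm p g := hardyNorm_nonneg
  refine hardyNorm_le (by linarith) (by positivity) fun r hr => ?_
  convert hardyMeanP_add_le_of_memHardy hp hf hg (half_pos hε) hr using 2
  ring

theorem MemHardy.smul (hf : MemHardy p f) (c : ℂ) : MemHardy p (c • f) := by
  obtain ⟨B, hB⟩ := hf.2
  refine MemHardy.of_le (hf.1.const_smul c) (c := ‖c‖ ^ p * B) fun r hr => ?_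
  rw [hardyMeanP_smul]
  exact mul_le_mul_of_nonneg_left (hB ⟨⟨r, hr⟩, rfl⟩) (by positivity)

theorem hardyNorm_smul (hp : 0 < p) (c : ℂ) : hardyNorm p (c • f) = ‖c‖ * hardyNorm p f := by
  simp_rw [hardyNorm, hardyMeanP_smul]
  rw [← Real.mul_iSup_of_nonneg (by positivity),
    Real.mul_rpow (by positivity) iSup_hardyMeanP_nonneg, one_div,
    Real.rpow_rpow_inv (norm_nonneg c) hp.ne']

theorem memHardy_zero (hp : 0 < p) : MemHardy p 0 :=
  MemHardy.of_le (differentiableOn_const 0) (c := 0) fun r _ => by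
    simp [hardyMeanP, Real.zero_rpow hp.ne']

/-- The growth estimate for functions in the Hardy space. -/
theorem norm_le_hardyNorm (hp : 1 < p) (hf : MemHardy p f) {ρ : ℝ} (hρ0 : 0 ≤ ρ) (hρ : ρ < 1)
    {w : ℂ} (hw : ‖w‖ ≤ ρ) : ‖f w‖ ≤ (4 / (1 - ρ)) ^ p⁻¹ * hardyNorm p f := by
  have hp0 : 0 < p := by linarith
  have hR : (1 + ρ) / 2 ∈ Ioo (0 : ℝ) 1 := ⟨by linarith, by linarith⟩
  have h1ρ : 0 < 1 - ρ := by linarith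
  have hN := hardyMeanP_le_hardyNorm_rpow hp0 hf hR
  have h := norm_rpow_le_hardyMeanP hp hf.1 hR (w := w)
    (by rw [mem_ball_zero_iff]; linarith)
  rw [← Real.rpow_le_rpow_iff (norm_nonneg _)
    (mul_nonneg (by positivity) hardyNorm_nonneg) hp0,
    Real.mul_rpow (by positivity) hardyNorm_nonneg, Real.rpow_inv_rpow (by positivity) hp0.ne']
  refine h.trans (mul_le_mul ?_ hN hardyMeanP_nonneg (by positivity))
  rw [div_le_div_iff₀ (by linarith) h1ρ]
  nlinarith [norm_nonneg w]

theorem hardyNorm_sub_rpow_le (hp : 1 < p) {η C : ℝ} (hη : 0 ≤ η) (hC0 : 0 ≤ C)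
    (hC : ∀ z w : ℂ, ‖z - w‖ ^ p ≤ η * (‖z‖ ^ p + ‖w‖ ^ p) +
      C * ((‖z‖ ^ p + ‖w‖ ^ p) / 2 - ‖(z + w) / 2‖ ^ p))
    (hf : MemHardy p f) (hg : MemHardy p g) :
    hardyNorm p (f - g) ^ p ≤ η * (hardyNorm p f ^ p + hardyNorm p g ^ p) +
      C * ((hardyNorm p f ^ p + hardyNorm p g ^ p) / 2 -
        hardyNorm p ((2⁻¹ : ℂ) • (f + g)) ^ p) := by
  have hp0 : 0 < p := by linarith
  have hm : MemHardy p ((2⁻¹ : ℂ) • (f + g)) := (hf.add hp hg).smul _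
  refine le_of_forall_pos_le_add fun ε hε => ?_
  rw [hardyNorm_rpow hp0 (f := f - g)]
  refine ciSup_le fun r => ?_
  have hδ : 0 < ε / (C + 1) := by positivity
  obtain ⟨s, hs⟩ := exists_lt_of_lt_ciSup
    (show hardyNorm p ((2⁻¹ : ℂ) • (f + g)) ^ p - ε / (C + 1) <
      ⨆ r : Ioo (0 : ℝ) 1, hardyMeanP p ((2⁻¹ : ℂ) • (f + g)) r by
      rw [← hardyNorm_rpow hp0]; linarith)
  have hR : max (r : ℝ) s ∈ Ioo (0 : ℝ) 1 := ⟨lt_max_of_lt_left r.2.1, max_lt r.2.2 s.2.2⟩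
  set R : ℝ := max (r : ℝ) s
  have h1 := hardyMeanP_mono hp (hf.1.sub hg.1) r.2 hR (le_max_left _ _)
  have h2 := hardyMeanP_mono hp hm.1 s.2 hR (le_max_right _ _)
  have h3 := hardyMeanP_sub_le hp hC hf.1 hg.1 hR
  have h4 := hardyMeanP_le_hardyNorm_rpow hp0 hf hR
  have h5 := hardyMeanP_le_hardyNorm_rpow hp0 hg hR
  have h6 : η * (hardyMeanP p f R + hardyMeanP p g R) ≤
      η * (hardyNorm p f ^ p + hardyNorm p g ^ p) :=
    mul_le_mul_of_nonneg_left (by linarith) hη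
  have h7 : C * ((hardyMeanP p f R + hardyMeanP p g R) / 2 -
      hardyMeanP p ((2⁻¹ : ℂ) • (f + g)) R) ≤
      C * ((hardyNorm p f ^ p + hardyNorm p g ^ p) / 2 -
        hardyNorm p ((2⁻¹ : ℂ) • (f + g)) ^ p + ε / (C + 1)) :=
    mul_le_mul_of_nonneg_left (by linarith) hC0
  have h8 : C * (ε / (C + 1)) ≤ ε := by
    rw [← mul_div_assoc, div_le_iff₀ (by positivity)]
    nlinarith
  rw [mul_add] at h7
  linarith

end HardyNorm

section HardySpace

variable (p : ℝ) [hp : Fact (1 < p)]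

/-- The functions in `H^p`, extended by zero outside the unit disk. -/
def hardySubmodule : Submodule ℂ (ℂ → ℂ) where
  carrier := {f | MemHardy p f ∧ ∀ z ∉ ball (0 : ℂ) 1, f z = 0}
  zero_mem' := ⟨memHardy_zero (zero_lt_one.trans hp.out), fun _ _ => rfl⟩
  add_mem' := fun hf hg => ⟨hf.1.add hp.out hg.1, fun z hz => by simp [hf.2 z hz, hg.2 z hz]⟩
  smul_mem' := fun c f hf => ⟨hf.1.smul c, fun z hz => by simp [hf.2 z hz]⟩

/-- The Hardy space `H^p` as a type. -/
def HardySpace : Type := hardySubmodule p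

noncomputable instance : AddCommGroup (HardySpace p) :=
  inferInstanceAs (AddCommGroup (hardySubmodule p))

noncomputable instance : Module ℂ (HardySpace p) :=
  inferInstanceAs (Module ℂ (hardySubmodule p))

namespace HardySpace

variable {p}

/-- The function on the plane underlying an element of the Hardy space. -/
def toFun (f : HardySpace p) : ℂ → ℂ := Subtype.val (p := (· ∈ hardySubmodule p)) f

theorem memHardy (f : HardySpace p) : MemHardy p f.toFun := f.2.1

theorem ext {f g : HardySpace p} (h : EqOn f.toFun g.toFun (ball 0 1)) : f = g := by
  refine Subtype.ext (funext fun z => ?_)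
  by_cases hz : z ∈ ball (0 : ℂ) 1
  · exact h hz
  · exact (f.2.2 z hz).trans (g.2.2 z hz).symm

theorem toFun_add (f g : HardySpace p) : (f + g).toFun = f.toFun + g.toFun := rfl

theorem toFun_sub (f g : HardySpace p) : (f - g).toFun = f.toFun - g.toFun := rfl

theorem toFun_smul (c : ℂ) (f : HardySpace p) : (c • f).toFun = c • f.toFun := rfl

/-- The element of the Hardy space determined by a function in `H^p`. -/
noncomputable def mk (f : ℂ → ℂ) (hf : MemHardy p f) : HardySpace p :=
  ⟨(ball (0 : ℂ) 1).indicator f, hf.congr fun _ hz => (indicator_of_mem hz f).symm,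
    fun _ hz => indicator_of_notMem hz f⟩

theorem toFun_mk {f : ℂ → ℂ} (hf : MemHardy p f) : EqOn (mk f hf).toFun f (ball 0 1) :=
  fun _ hz => indicator_of_mem hz f

noncomputable instance : Norm (HardySpace p) := ⟨fun f => hardyNorm p f.toFun⟩

theorem norm_def (f : HardySpace p) : ‖f‖ = hardyNorm p f.toFun := rfl

theorem norm_toFun_le (f : HardySpace p) {ρ : ℝ} (hρ0 : 0 ≤ ρ) (hρ : ρ < 1) {w : ℂ}
    (hw : ‖w‖ ≤ ρ) : ‖f.toFun w‖ ≤ (4 / (1 - ρ)) ^ p⁻¹ * ‖f‖ :=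
  norm_le_hardyNorm hp.out f.memHardy hρ0 hρ hw

theorem core : NormedSpace.Core ℂ (HardySpace p) where
  norm_nonneg _ := hardyNorm_nonneg
  norm_smul c _ := hardyNorm_smul (zero_lt_one.trans hp.out) c
  norm_triangle f g := hardyNorm_add_le hp.out f.memHardy g.memHardy
  norm_eq_zero_iff f := by
    constructor
    · intro h
      refine HardySpace.ext fun z hz => ?_
      have := f.norm_toFun_le (norm_nonneg z) (by simpa using hz) le_rfl
      rw [h, mul_zero] at this
      exact norm_le_zero_iff.1 this
    · rintro rfl
      have := hardyNorm_smul (f := 0) (zero_lt_one.trans hp.out) 0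
      rwa [norm_zero, zero_mul, smul_zero] at this

noncomputable instance : NormedAddCommGroup (HardySpace p) := NormedAddCommGroup.ofCore core

noncomputable instance : NormedSpace ℂ (HardySpace p) := NormedSpace.ofCore core

/-- Point evaluation on the Hardy space. -/
noncomputable def eval (z : ball (0 : ℂ) 1) : HardySpace p →L[ℂ] ℂ :=
  LinearMap.mkContinuous
    { toFun := fun f => f.toFun z
      map_add' := fun _ _ => rfl
      map_smul' := fun _ _ => rfl } ((4 / (1 - ‖(z : ℂ)‖)) ^ p⁻¹)
    fun f => f.norm_toFun_le (norm_nonneg _) (mem_ball_zero_iff.1 z.2) le_rfl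

theorem eq_of_eval_eq {f g : HardySpace p} (h : ∀ z, eval z f = eval z g) : f = g :=
  HardySpace.ext fun z hz => h ⟨z, hz⟩

theorem exists_norm_sub_rpow_le {η : ℝ} (hη : 0 < η) :
    ∃ C : ℝ, 0 ≤ C ∧ ∀ f g : HardySpace p, ‖f - g‖ ^ p ≤ η * (‖f‖ ^ p + ‖g‖ ^ p) +
      C * ((‖f‖ ^ p + ‖g‖ ^ p) / 2 - ‖(2⁻¹ : ℂ) • (f + g)‖ ^ p) := by
  obtain ⟨C, hC0, hC⟩ := _root_.exists_norm_sub_rpow_le hp.out hη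
  exact ⟨C, hC0, fun f g => hardyNorm_sub_rpow_le hp.out hη.le hC0 hC f.memHardy g.memHardy⟩

theorem tendsto_hardyMeanP {u : ℕ → HardySpace p} {B : ℝ} (hB : ∀ n, ‖u n‖ ≤ B) {F : ℂ → ℂ}
    (hF : ∀ z ∈ ball (0 : ℂ) 1, Tendsto (fun n => (u n).toFun z) atTop (𝓝 (F z)))
    {r : ℝ} (hr : r ∈ Ioo (0 : ℝ) 1) :
    Tendsto (fun n => hardyMeanP p (u n).toFun r) atTop (𝓝 (hardyMeanP p F r)) := by
  have hp0 : 0 < p := zero_lt_one.trans hp.out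
  have hmem (θ : ℝ) : circleMap 0 r θ ∈ ball (0 : ℂ) 1 := by
    simpa [abs_of_pos hr.1] using hr.2
  simp_rw [hardyMeanP_eq_circleAverage, Real.circleAverage]
  refine Tendsto.const_smul ?_ _
  refine intervalIntegral.tendsto_integral_filter_of_dominated_convergence
    (fun _ => ((4 / (1 - r)) ^ p⁻¹ * B) ^ p) ?_ ?_ ?_ ?_
  · refine Eventually.of_forall fun n => ?_
    have := circleIntegrable_norm_rpow hp0.le (u n).memHardy.1 hr
    exact (intervalIntegrable_iff.1 this).aestronglyMeasurable
  · refine Eventually.of_forall fun n => ae_of_all _ fun θ _ => ?_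
    rw [Real.norm_of_nonneg (by positivity)]
    have h1 : 0 ≤ 4 / (1 - r) := div_nonneg (by norm_num) (by linarith [hr.2])
    refine Real.rpow_le_rpow (norm_nonneg _) ?_ hp0.le
    refine ((u n).norm_toFun_le hr.1.le hr.2 (by simp [abs_of_pos hr.1])).trans ?_
    exact mul_le_mul_of_nonneg_left (hB n) (by positivity)
  · exact intervalIntegrable_const
  · exact ae_of_all _ fun θ _ => (hF _ (hmem θ)).norm.rpow_const (Or.inr hp0.le)

theorem exists_tendsto_of_cauchySeq {u : ℕ → HardySpace p} (hu : CauchySeq u) :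
    ∃ f, Tendsto u atTop (𝓝 f) := by
  classical
  have hp0 : 0 < p := zero_lt_one.trans hp.out
  have hpt : ∀ z : ball (0 : ℂ) 1, ∃ c, Tendsto (fun n => eval z (u n)) atTop (𝓝 c) := fun z =>
    cauchySeq_tendsto_of_complete ((eval z).uniformContinuous.comp_cauchySeq hu)
  choose c hc using hpt
  set F : ℂ → ℂ := fun z => if hz : z ∈ ball (0 : ℂ) 1 then c ⟨z, hz⟩ else 0 with hF
  have hFt : ∀ z ∈ ball (0 : ℂ) 1, Tendsto (fun n => (u n).toFun z) atTop (𝓝 (F z)) := by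
    intro z hz
    simp only [hF, hz, dif_pos]
    exact hc ⟨z, hz⟩
  have huni : ∀ ρ, 0 ≤ ρ → ρ < 1 →
      TendstoUniformlyOn (fun n => (u n).toFun) F atTop (closedBall 0 ρ) := by
    intro ρ hρ0 hρ
    refine UniformCauchySeqOn.tendstoUniformlyOn_of_tendsto ?_
      fun z hz => hFt z (closedBall_subset_ball hρ hz)
    rw [Metric.uniformCauchySeqOn_iff]
    intro ε hε
    have hK : 0 < (4 / (1 - ρ)) ^ p⁻¹ :=
      Real.rpow_pos_of_pos (div_pos (by norm_num) (by linarith)) _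
    obtain ⟨N, hN⟩ := Metric.cauchySeq_iff.1 hu (ε / (4 / (1 - ρ)) ^ p⁻¹) (by positivity)
    refine ⟨N, fun m hm n hn z hz => ?_⟩
    have h1 := hN m hm n hn
    rw [dist_eq_norm, lt_div_iff₀' hK] at h1
    rw [dist_eq_norm]
    exact ((u m - u n).norm_toFun_le hρ0 hρ (by simpa using hz)).trans_lt h1
  have hFd : DifferentiableOn ℂ F (ball 0 1) := by
    refine TendstoLocallyUniformlyOn.differentiableOn (φ := atTop) (F := fun n => (u n).toFun) ?_
      (Eventually.of_forall fun n => (u n).memHardy.1) isOpen_ball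
    refine (tendstoLocallyUniformlyOn_iff_forall_isCompact isOpen_ball).2 fun K hK hKc => ?_
    rcases K.eq_empty_or_nonempty with rfl | hne
    · exact tendstoUniformlyOn_empty
    obtain ⟨z₀, hz₀, hmax⟩ := hKc.exists_isMaxOn hne continuous_norm.continuousOn
    refine (huni ‖z₀‖ (norm_nonneg _) (by simpa using hK hz₀)).mono fun z hz => ?_
    simpa using hmax hz
  have hbd : ∀ ε > 0, ∃ N, ∀ n ≥ N, ∀ r ∈ Ioo (0 : ℝ) 1,
      hardyMeanP p (F - (u n).toFun) r ≤ ε ^ p := by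
    intro ε hε
    obtain ⟨N, hN⟩ := Metric.cauchySeq_iff.1 hu ε hε
    refine ⟨N, fun n hn r hr => ?_⟩
    have hle : ∀ m, ‖u (m + N) - u n‖ ≤ ε := fun m => by
      rw [← dist_eq_norm]; exact (hN (m + N) (by simp) n hn).le
    have ht := tendsto_hardyMeanP (u := fun m => u (m + N) - u n) hle (F := F - (u n).toFun)
      (fun z hz => ((tendsto_add_atTop_iff_nat N).2 (hFt z hz)).sub_const _) hr
    refine le_of_tendsto ht (Eventually.of_forall fun m => ?_)
    exact (hardyMeanP_le_hardyNorm_rpow hp0 (memHardy _) hr).trans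
      (Real.rpow_le_rpow hardyNorm_nonneg (hle m) hp0.le)
  have hFm : MemHardy p F := by
    obtain ⟨N, hN⟩ := hbd 1 one_pos
    have h1 : MemHardy p (F - (u N).toFun) :=
      MemHardy.of_le (hFd.sub (u N).memHardy.1) (hN N le_rfl)
    have h2 := h1.add hp.out (u N).memHardy
    rwa [sub_add_cancel] at h2
  refine ⟨mk F hFm, Metric.tendsto_atTop.2 fun ε hε => ?_⟩
  obtain ⟨N, hN⟩ := hbd (ε / 2) (half_pos hε)
  refine ⟨N, fun n hn => ?_⟩
  rw [dist_comm, dist_eq_norm, norm_def]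
  refine lt_of_le_of_lt ?_ (half_lt_self hε)
  rw [hardyNorm_congr (g := F - (u n).toFun) fun z hz => by
    rw [toFun_sub, Pi.sub_apply, Pi.sub_apply, toFun_mk hFm hz]]
  exact hardyNorm_le hp0 (half_pos hε).le (hN n hn)

instance : CompleteSpace (HardySpace p) :=
  Metric.complete_of_cauchySeq_tendsto fun _ hu => exists_tendsto_of_cauchySeq hu

end HardySpace

end HardySpace

section ConvexCombinations

variable {X : Type*} [NormedAddCommGroup X] [NormedSpace ℂ X] {p : ℝ}

/-- In a uniformly convex space, almost minimal elements of a decreasing sequence of bounded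
convex sets form a Cauchy sequence. -/
theorem exists_cauchySeq_mem_of_antitone (hp : 0 < p)
    (hX : ∀ η : ℝ, 0 < η → ∃ C : ℝ, 0 ≤ C ∧ ∀ x y : X, ‖x - y‖ ^ p ≤ η * (‖x‖ ^ p + ‖y‖ ^ p) +
      C * ((‖x‖ ^ p + ‖y‖ ^ p) / 2 - ‖(2⁻¹ : ℂ) • (x + y)‖ ^ p))
    {K : ℕ → Set X} (hanti : Antitone K) (hconv : ∀ n, Convex ℝ (K n))
    (hne : ∀ n, (K n).Nonempty) {B : ℝ} (hB : ∀ x ∈ K 0, ‖x‖ ≤ B) :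
    ∃ g : ℕ → X, (∀ n, g n ∈ K n) ∧ CauchySeq g := by
  set d : ℕ → ℝ := fun n => infDist 0 (K n) with hd
  have hdle : ∀ n, ∀ x ∈ K n, d n ≤ ‖x‖ := fun n x hx => by
    simpa using infDist_le_dist_of_mem (x := (0 : X)) hx
  have hdmono : Monotone d := fun m n hmn => infDist_le_infDist_of_subset (hanti hmn) (hne n)
  have hdB : ∀ n, d n ≤ B := fun n => by
    obtain ⟨x, hx⟩ := hne n
    exact (hdle n x hx).trans (hB x (hanti (Nat.zero_le n) hx))
  have hlim := tendsto_atTop_ciSup hdmono ⟨B, by rintro _ ⟨n, rfl⟩; exact hdB n⟩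
  set L := ⨆ n, d n
  have hex : ∀ n : ℕ, ∃ x ∈ K n, ‖x‖ < d n + 1 / ((n : ℝ) + 1) := fun n => by
    obtain ⟨x, hx, hlt⟩ := (infDist_lt_iff (hne n)).1
      (lt_add_of_pos_right (d n) (Nat.one_div_pos_of_nat (α := ℝ) (n := n)))
    exact ⟨x, hx, by simpa using hlt⟩
  choose g hgK hg using hex
  refine ⟨g, hgK, ?_⟩
  have hgL : Tendsto (fun n => ‖g n‖) atTop (𝓝 L) := by
    refine tendsto_of_tendsto_of_tendsto_of_le_of_le hlim ?_ (fun n => hdle n _ (hgK n))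
      fun n => (hg n).le
    simpa using hlim.add (tendsto_one_div_add_atTop_nhds_zero_nat (𝕜 := ℝ))
  have hgp := hgL.rpow_const (p := p) (Or.inr hp.le)
  have hdp := hlim.rpow_const (p := p) (Or.inr hp.le)
  have hL0 : 0 ≤ L := ge_of_tendsto hlim (Eventually.of_forall fun n => infDist_nonneg)
  have hΛ0 : 0 ≤ L ^ p := by positivity
  set Λ := L ^ p
  rw [Metric.cauchySeq_iff]
  intro ε hε
  have hεp : 0 < ε ^ p := by positivity
  obtain ⟨C, hC0, hC⟩ := hX (ε ^ p / (4 * (Λ + 1))) (by positivity)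
  set δ := min 1 (ε ^ p / (8 * (C + 1)))
  have hδ : 0 < δ := lt_min one_pos (by positivity)
  obtain ⟨N, hN⟩ := eventually_atTop.1 ((hgp.eventually_lt_const (lt_add_of_pos_right Λ hδ)).and
    (hdp.eventually_const_lt (sub_lt_self Λ hδ)))
  refine ⟨N, fun m hm n hn => ?_⟩
  rw [dist_eq_norm, ← Real.rpow_lt_rpow_iff (norm_nonneg _) hε.le hp]
  have hmid : (2⁻¹ : ℂ) • (g m + g n) ∈ K N := by
    have := hconv N (hanti hm (hgK m)) (hanti hn (hgK n))
      (by norm_num : (0 : ℝ) ≤ 1 / 2) (by norm_num : (0 : ℝ) ≤ 1 / 2) (by norm_num)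
    rw [← smul_add] at this
    convert this using 1
    rw [← Complex.coe_smul]
    norm_num
  have h1 : d N ^ p ≤ ‖(2⁻¹ : ℂ) • (g m + g n)‖ ^ p :=
    Real.rpow_le_rpow infDist_nonneg (hdle N _ hmid) hp.le
  have h2 := (hN N le_rfl).2
  have h3 := (hN m hm).1
  have h4 := (hN n hn).1
  have h5 : δ ≤ 1 := min_le_left _ _
  have h6 : δ * (8 * (C + 1)) ≤ ε ^ p := (le_div_iff₀ (by positivity)).1 (min_le_right _ _)
  have h7 : ε ^ p / (4 * (Λ + 1)) * (‖g m‖ ^ p + ‖g n‖ ^ p) ≤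
      ε ^ p / (4 * (Λ + 1)) * (2 * (Λ + 1)) := by
    gcongr; linarith
  have h8 : ε ^ p / (4 * (Λ + 1)) * (2 * (Λ + 1)) = ε ^ p / 2 := by
    field_simp; norm_num
  have h9 : C * ((‖g m‖ ^ p + ‖g n‖ ^ p) / 2 - ‖(2⁻¹ : ℂ) • (g m + g n)‖ ^ p) ≤ C * (2 * δ) := by
    gcongr; linarith
  have h10 := hC (g m) (g n)
  nlinarith

theorem tendsto_of_mem_convexHull {u g : ℕ → X} (hg : ∀ n, g n ∈ convexHull ℝ (u '' Ici n))
    (φ : X →L[ℂ] ℂ) {c : ℂ} (hu : Tendsto (fun n => φ (u n)) atTop (𝓝 c)) :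
    Tendsto (fun n => φ (g n)) atTop (𝓝 c) := by
  rw [Metric.tendsto_atTop] at hu ⊢
  intro ε hε
  obtain ⟨N, hN⟩ := hu ε hε
  refine ⟨N, fun n hn => ?_⟩
  have hsub : convexHull ℝ (u '' Ici n) ⊆ (φ.restrictScalars ℝ : X →ₗ[ℝ] ℂ) ⁻¹' ball c ε :=
    convexHull_min (by rintro _ ⟨m, hm, rfl⟩; exact hN m (hn.trans hm))
      ((convex_ball c ε).linear_preimage _)
  exact hsub (hg n)

variable [CompleteSpace X] (hp : 0 < p)
    (hX : ∀ η : ℝ, 0 < η → ∃ C : ℝ, 0 ≤ C ∧ ∀ x y : X, ‖x - y‖ ^ p ≤ η * (‖x‖ ^ p + ‖y‖ ^ p) +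
      C * ((‖x‖ ^ p + ‖y‖ ^ p) / 2 - ‖(2⁻¹ : ℂ) • (x + y)‖ ^ p))

include hp hX in
theorem exists_tendsto_mem_convexHull {u : ℕ → X} {B : ℝ} (hB : ∀ n, ‖u n‖ ≤ B) :
    ∃ (g : ℕ → X) (x : X), (∀ n, g n ∈ convexHull ℝ (u '' Ici n)) ∧ Tendsto g atTop (𝓝 x) := by
  obtain ⟨g, hg, hc⟩ := exists_cauchySeq_mem_of_antitone hp hX
    (K := fun n => convexHull ℝ (u '' Ici n))
    (fun m n hmn => convexHull_mono (image_mono (Ici_subset_Ici.2 hmn)))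
    (fun n => convex_convexHull ℝ _)
    (fun n => convexHull_nonempty_iff.2 ⟨u n, n, self_mem_Ici, rfl⟩) (B := B) (by
      have : convexHull ℝ (u '' Ici 0) ⊆ closedBall 0 B := convexHull_min
        (by rintro _ ⟨m, -, rfl⟩; simpa using hB m) (convex_closedBall 0 B)
      intro x hx
      simpa using this hx)
  obtain ⟨x, hx⟩ := cauchySeq_tendsto_of_complete hc
  exact ⟨g, x, hg, hx⟩

variable {ι : Type*} {e : ι → X →L[ℂ] ℂ}

include hp hX in
theorem exists_mem_closure_convexHull_forall_eq {u : ℕ → X} {B : ℝ} (hB : ∀ n, ‖u n‖ ≤ B)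
    {c : ι → ℂ} (hc : ∀ i, Tendsto (fun n => e i (u n)) atTop (𝓝 (c i))) :
    ∃ x ∈ closure (convexHull ℝ (range u)), ∀ i, e i x = c i := by
  obtain ⟨g, x, hg, hx⟩ := exists_tendsto_mem_convexHull hp hX hB
  refine ⟨x, mem_closure_of_tendsto hx (Eventually.of_forall fun n =>
    convexHull_mono (image_subset_range _ _) (hg n)), fun i => ?_⟩
  exact tendsto_nhds_unique (((e i).continuous.tendsto x).comp hx)
    (tendsto_of_mem_convexHull hg (e i) (hc i))

include hp hX in
theorem eval_apply_eq_of_tendsto (he : ∀ x y, (∀ i, e i x = e i y) → x = y)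
    {u : ℕ → X} {B : ℝ} (hB : ∀ n, ‖u n‖ ≤ B) {x : X}
    (hx : ∀ i, Tendsto (fun n => e i (u n)) atTop (𝓝 (e i x))) (S : X →L[ℂ] X) {i : ι} {c : ℂ}
    (hc : Tendsto (fun n => e i (S (u n))) atTop (𝓝 c)) : e i (S x) = c := by
  obtain ⟨g, x', hg, hx'⟩ := exists_tendsto_mem_convexHull hp hX hB
  have hxx : x' = x := he _ _ fun j => tendsto_nhds_unique (((e j).continuous.tendsto x').comp hx')
    (tendsto_of_mem_convexHull hg (e j) (hx j))
  subst hxx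
  exact tendsto_nhds_unique ((((e i).comp S).continuous.tendsto x').comp hx')
    (tendsto_of_mem_convexHull hg ((e i).comp S) hc)

end ConvexCombinations

section RightRiemannSums

variable {ψ : ℝ → ℂ} {B : ℝ}

theorem right_endpoint_mem {n : ℕ} {s : ℝ} (hs : s ∈ Ico (0 : ℝ) 1) :
    ((⌊((n : ℝ) + 1) * s⌋₊ : ℝ) + 1) / (n + 1) ∈ Ioc s (min 1 (s + 1 / (n + 1))) := by
  have hN : (0 : ℝ) < n + 1 := by positivity
  have h1 := Nat.lt_floor_add_one (((n : ℝ) + 1) * s)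
  have h2 := Nat.floor_le (mul_nonneg hN.le hs.1)
  have h3 : ⌊((n : ℝ) + 1) * s⌋₊ < n + 1 := by
    rw [Nat.floor_lt (mul_nonneg hN.le hs.1)]
    push_cast
    nlinarith [hs.2]
  have h4 : (⌊((n : ℝ) + 1) * s⌋₊ : ℝ) + 1 ≤ n + 1 := by exact_mod_cast h3
  refine ⟨by rw [lt_div_iff₀ hN]; linarith, le_min ((div_le_one hN).2 h4) ?_⟩
  rw [add_div]
  gcongr
  rw [div_le_iff₀ hN]; linarith

theorem integral_right_step (n : ℕ) :
    ∫ s in (0 : ℝ)..1, ψ (((⌊((n : ℝ) + 1) * s⌋₊ : ℝ) + 1) / (n + 1)) =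
      ((n : ℂ) + 1)⁻¹ * ∑ k ∈ Finset.range (n + 1), ψ (((k : ℝ) + 1) / (n + 1)) := by
  have hN : (0 : ℝ) < n + 1 := by positivity
  have hstep : ∀ k : ℕ, EqOn (fun s : ℝ => ψ (((⌊((n : ℝ) + 1) * s⌋₊ : ℝ) + 1) / (n + 1)))
      (fun _ => ψ (((k : ℝ) + 1) / (n + 1)))
      (Ioo ((k : ℝ) / (n + 1)) (((k + 1 : ℕ) : ℝ) / (n + 1))) := by
    rintro k s ⟨h1, h2⟩
    rw [div_lt_iff₀ hN] at h1
    rw [lt_div_iff₀ hN] at h2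
    push_cast at h2
    have : ⌊((n : ℝ) + 1) * s⌋₊ = k := by
      rw [Nat.floor_eq_iff (by nlinarith [Nat.cast_nonneg (α := ℝ) k])]
      constructor <;> linarith
    simp only [this]
  have hle : ∀ k : ℕ, (k : ℝ) / (n + 1) ≤ ((k + 1 : ℕ) : ℝ) / (n + 1) := fun k => by
    gcongr; simp
  have hsum := intervalIntegral.sum_integral_adjacent_intervals (μ := volume)
    (f := fun s : ℝ => ψ (((⌊((n : ℝ) + 1) * s⌋₊ : ℝ) + 1) / (n + 1)))
    (a := fun k : ℕ => (k : ℝ) / (n + 1)) (n := n + 1) fun k _ => by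
      refine IntervalIntegrable.congr_uIoo (f := fun _ => ψ (((k : ℝ) + 1) / (n + 1)))
        intervalIntegrable_const ?_
      rw [uIoo_of_le (hle k)]
      exact (hstep k).symm
  have h01 : (((n + 1 : ℕ) : ℝ) / (n + 1)) = 1 := by
    push_cast; exact div_self hN.ne'
  simp only [h01, Nat.cast_zero, zero_div] at hsum
  rw [← hsum, Finset.mul_sum]
  refine Finset.sum_congr rfl fun k _ => ?_
  rw [intervalIntegral.integral_congr_Ioo_of_le (hle k) (hstep k),
    intervalIntegral.integral_const, ← sub_div]
  push_cast
  rw [add_sub_cancel_left, Complex.real_smul]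
  push_cast
  rw [one_div]

/-- Riemann sums of a bounded right-continuous function converge to its integral. -/
theorem tendsto_right_riemann_sum (hB : ∀ s ∈ Icc (0 : ℝ) 1, ‖ψ s‖ ≤ B)
    (hψ : ∀ s ∈ Ico (0 : ℝ) 1, Tendsto ψ (𝓝[>] s) (𝓝 (ψ s))) :
    IntervalIntegrable ψ volume 0 1 ∧
    Tendsto (fun n : ℕ => ((n : ℂ) + 1)⁻¹ *
      ∑ k ∈ Finset.range (n + 1), ψ (((k : ℝ) + 1) / (n + 1))) atTop
      (𝓝 (∫ s in (0 : ℝ)..1, ψ s)) := by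
  set F : ℕ → ℝ → ℂ := fun n s => ψ (((⌊((n : ℝ) + 1) * s⌋₊ : ℝ) + 1) / (n + 1))
  have hmeas : ∀ n, Measurable (F n) := fun n =>
    (measurable_from_nat (f := fun k : ℕ => ψ (((k : ℝ) + 1) / (n + 1)))).comp
      (Nat.measurable_floor.comp (measurable_const_mul ((n : ℝ) + 1)))
  have hlim : ∀ s ∈ Ico (0 : ℝ) 1, Tendsto (fun n => F n s) atTop (𝓝 (ψ s)) := fun s hs => by
    refine (hψ s hs).comp (tendsto_nhdsWithin_iff.2 ⟨?_, Eventually.of_forall fun n =>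
      (right_endpoint_mem hs).1⟩)
    refine tendsto_of_tendsto_of_tendsto_of_le_of_le tendsto_const_nhds ?_
      (fun n => (right_endpoint_mem hs).1.le)
      fun n => (right_endpoint_mem hs).2.trans (min_le_right _ _)
    simpa using (tendsto_one_div_add_atTop_nhds_zero_nat (𝕜 := ℝ)).const_add s
  have hbd : ∀ n, ∀ s ∈ Ico (0 : ℝ) 1, ‖F n s‖ ≤ B := fun n s hs =>
    hB _ ⟨hs.1.trans (right_endpoint_mem hs).1.le,
      (right_endpoint_mem hs).2.trans (min_le_left _ _)⟩
  have hae : ∀ {P : ℝ → Prop}, (∀ s ∈ Ico (0 : ℝ) 1, P s) →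
      ∀ᵐ s ∂(volume.restrict (Ioc (0 : ℝ) 1)), P s := fun {P} h => by
    rw [← restrict_Ico_eq_restrict_Ioc]
    exact ae_restrict_of_forall_mem measurableSet_Ico h
  have hsm : AEStronglyMeasurable ψ (volume.restrict (Ioc (0 : ℝ) 1)) :=
    aestronglyMeasurable_of_tendsto_ae atTop (fun n => (hmeas n).aestronglyMeasurable) (hae hlim)
  constructor
  · rw [intervalIntegrable_iff_integrableOn_Ioc_of_le zero_le_one]
    exact (integrable_const B).mono' hsm
      (hae fun s hs => hB s (Ico_subset_Icc_self hs))
  · simp_rw [← integral_right_step]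
    simp only [intervalIntegral.integral_of_le zero_le_one]
    exact tendsto_integral_of_dominated_convergence (fun _ => B)
      (fun n => (hmeas n).aestronglyMeasurable) (integrable_const B)
      (fun n => hae (hbd n)) (hae hlim)

end RightRiemannSums

section WeaklyContinuousSemigroup

variable {X : Type*} [NormedAddCommGroup X] [NormedSpace ℂ X] {ι : Type*} {e : ι → X →L[ℂ] ℂ}
  {S : ℝ → X →L[ℂ] X} {M : ℝ}

/-- The average over `[a, a + h]` of the scalar orbit of `x` under `S`, tested against `φ`. -/
noncomputable def orbitMean (φ : X →L[ℂ] ℂ) (S : ℝ → X →L[ℂ] X) (x : X) (a h : ℝ) : ℂ :=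
  ∫ s in (0 : ℝ)..1, φ (S (a + h * s) x)

/-- The right-endpoint Riemann sums for the average of the orbit of `x` over `[a, a + h]`. -/
noncomputable def orbitSum (S : ℝ → X →L[ℂ] X) (x : X) (a h : ℝ) (n : ℕ) : X :=
  ((n : ℂ) + 1)⁻¹ • ∑ k ∈ Finset.range (n + 1), S (a + h * (((k : ℝ) + 1) / (n + 1))) x

theorem right_endpoint_fraction_mem {n k : ℕ} (hk : k ∈ Finset.range (n + 1)) :
    ((k : ℝ) + 1) / (n + 1) ∈ Icc (0 : ℝ) 1 := by
  refine ⟨by positivity, (div_le_one (by positivity)).2 ?_⟩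
  exact_mod_cast Finset.mem_range.1 hk

theorem orbit_time_mem {a h s : ℝ} (ha : 0 ≤ a) (hh : 0 ≤ h) (hah : a + h < 1)
    (hs : s ∈ Icc (0 : ℝ) 1) : a + h * s ∈ Ico (0 : ℝ) 1 :=
  ⟨add_nonneg ha (mul_nonneg hh hs.1), by nlinarith [hs.2]⟩

theorem apply_orbitSum (hadd : ∀ s, 0 ≤ s → ∀ t, 0 ≤ t → ∀ x, S (s + t) x = S s (S t x))
    {x : X} {a h u : ℝ} (ha : 0 ≤ a) (hh : 0 ≤ h) (hu : 0 ≤ u) (n : ℕ) :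
    S u (orbitSum S x a h n) = orbitSum S x (u + a) h n := by
  rw [orbitSum, orbitSum, map_smul, map_sum]
  congr 1
  refine Finset.sum_congr rfl fun k _ => ?_
  rw [← hadd u hu _ (by positivity), add_assoc]

theorem norm_orbitSum_le (hM : ∀ t ∈ Ico (0 : ℝ) 1, ∀ x, ‖S t x‖ ≤ M * ‖x‖)
    {x : X} {a h : ℝ} (ha : 0 ≤ a) (hh : 0 ≤ h) (hah : a + h < 1) (n : ℕ) :
    ‖orbitSum S x a h n‖ ≤ M * ‖x‖ := by
  rw [orbitSum, norm_smul, norm_inv]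
  have h1 : ‖((n : ℂ) + 1)‖ = (n : ℝ) + 1 := by
    rw [← Nat.cast_succ, Complex.norm_natCast, Nat.cast_succ]
  rw [h1, inv_mul_le_iff₀ (by positivity)]
  refine (norm_sum_le_of_le _ fun k hk =>
    hM _ (orbit_time_mem ha hh hah (right_endpoint_fraction_mem hk)) x).trans ?_
  simp

theorem tendsto_orbit_nhdsGT
    (hadd : ∀ s, 0 ≤ s → ∀ t, 0 ≤ t → ∀ x, S (s + t) x = S s (S t x))
    (hweak : ∀ i x, Tendsto (fun t => e i (S t x)) (𝓝[>] (0 : ℝ)) (𝓝 (e i x)))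
    (i : ι) (x : X) {s : ℝ} (hs : 0 ≤ s) :
    Tendsto (fun t => e i (S t x)) (𝓝[>] s) (𝓝 (e i (S s x))) := by
  have h1 : Tendsto (fun t => t - s) (𝓝[>] s) (𝓝[>] 0) := by
    refine tendsto_nhdsWithin_iff.2 ⟨?_, eventually_nhdsWithin_of_forall fun t ht =>
      mem_Ioi.2 (sub_pos.2 ht)⟩
    have : Tendsto (fun t : ℝ => t - s) (𝓝 s) (𝓝 (s - s)) := tendsto_id.sub_const s
    rw [sub_self] at this
    exact this.mono_left nhdsWithin_le_nhds
  refine ((hweak i (S s x)).comp h1).congr' ?_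
  filter_upwards [self_mem_nhdsWithin] with t ht
  rw [Function.comp_apply, ← hadd _ (sub_nonneg.2 (le_of_lt ht)) s hs, sub_add_cancel]

variable (hadd : ∀ s, 0 ≤ s → ∀ t, 0 ≤ t → ∀ x, S (s + t) x = S s (S t x))
  (hweak : ∀ i x, Tendsto (fun t => e i (S t x)) (𝓝[>] (0 : ℝ)) (𝓝 (e i x)))
  (hM : ∀ t ∈ Ico (0 : ℝ) 1, ∀ x, ‖S t x‖ ≤ M * ‖x‖)

include hadd hweak hM

theorem tendsto_orbitSum (i : ι) (x : X) {a h : ℝ} (ha : 0 ≤ a) (hh : 0 < h) (hah : a + h < 1) :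
    IntervalIntegrable (fun s => e i (S (a + h * s) x)) volume 0 1 ∧
    Tendsto (fun n => e i (orbitSum S x a h n)) atTop (𝓝 (orbitMean (e i) S x a h)) := by
  have hlim : ∀ s ∈ Ico (0 : ℝ) 1, Tendsto (fun s => e i (S (a + h * s) x)) (𝓝[>] s)
      (𝓝 (e i (S (a + h * s) x))) := fun s hs => by
    refine (tendsto_orbit_nhdsGT hadd hweak i x
      (add_nonneg ha (mul_nonneg hh.le hs.1))).comp ?_
    refine tendsto_nhdsWithin_iff.2 ⟨?_, eventually_nhdsWithin_of_forall fun t ht =>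
      mem_Ioi.2 (by gcongr; exact ht)⟩
    exact ((continuous_const.add (continuous_const.mul continuous_id)).tendsto s).mono_left
      nhdsWithin_le_nhds
  have := tendsto_right_riemann_sum (B := ‖e i‖ * (M * ‖x‖)) (fun s hs =>
    ((e i).le_opNorm _).trans (mul_le_mul_of_nonneg_left
      (hM _ (orbit_time_mem ha hh.le hah hs) x) (norm_nonneg _))) hlim
  refine ⟨this.1, this.2.congr fun n => ?_⟩
  rw [orbitSum, map_smul, map_sum, smul_eq_mul]

theorem intervalIntegrable_orbit (i : ι) (x : X) {b : ℝ} (hb0 : 0 < b) (hb : b < 1) :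
    IntervalIntegrable (fun t => e i (S t x)) volume 0 b := by
  have h1 := (tendsto_orbitSum hadd hweak hM i x le_rfl hb0 (by rwa [zero_add])).1
  simp only [zero_add] at h1
  have h2 := h1.comp_mul_left (c := b⁻¹)
  simpa [mul_inv_cancel_left₀ hb0.ne'] using h2

omit hadd hweak hM in
theorem smul_orbitMean (φ : X →L[ℂ] ℂ) (x : X) (a h : ℝ) :
    (h : ℂ) * orbitMean φ S x a h = ∫ t in a..a + h, φ (S t x) := by
  have := intervalIntegral.smul_integral_comp_add_mul (a := 0) (b := 1)
    (fun t => φ (S t x)) h a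
  simpa [Complex.real_smul, orbitMean] using this

theorem mul_orbitMean_sub (i : ι) (x : X) {h u : ℝ} (hh : 0 < h) (hu : 0 < u) (hhu : h + u < 1) :
    (h : ℂ) * (orbitMean (e i) S x u h - orbitMean (e i) S x 0 h) =
      u * (orbitMean (e i) S x h u - orbitMean (e i) S x 0 u) := by
  have horbit : ∀ a b : ℝ, a ∈ Icc 0 (h + u) → b ∈ Icc 0 (h + u) →
      IntervalIntegrable (fun t => e i (S t x)) volume a b := fun a b ha hb => by
    refine (intervalIntegrable_orbit hadd hweak hM i x (add_pos hh hu) hhu).mono_set ?_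
    rw [uIcc_of_le (add_pos hh hu).le]
    exact uIcc_subset_Icc ha hb
  rw [mul_sub, mul_sub, smul_orbitMean, smul_orbitMean, smul_orbitMean, smul_orbitMean,
    zero_add, zero_add, add_comm u h]
  have m0 : (0 : ℝ) ∈ Icc 0 (h + u) := ⟨le_rfl, by positivity⟩
  have mh : h ∈ Icc 0 (h + u) := ⟨hh.le, by linarith⟩
  have mu : u ∈ Icc 0 (h + u) := ⟨hu.le, by linarith⟩
  have mhu : h + u ∈ Icc 0 (h + u) := ⟨by positivity, le_rfl⟩
  have h1 := intervalIntegral.integral_add_adjacent_intervals (horbit 0 u m0 mu) (horbit u _ mu mhu)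
  have h2 := intervalIntegral.integral_add_adjacent_intervals (horbit 0 h m0 mh) (horbit h _ mh mhu)
  linear_combination h1 - h2

theorem tendsto_orbitMean (hS0 : ∀ x, S 0 x = x) (i : ι) (x : X) {h : ℕ → ℝ}
    (hh : ∀ n, h n ∈ Ioo (0 : ℝ) 1) (hlim : Tendsto h atTop (𝓝 0)) :
    Tendsto (fun n => orbitMean (e i) S x 0 (h n)) atTop (𝓝 (e i x)) := by
  have hconst : e i x = ∫ _ in (0 : ℝ)..1, e i x := by simp
  rw [hconst]
  refine intervalIntegral.tendsto_integral_filter_of_dominated_convergence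
    (fun _ => ‖e i‖ * (M * ‖x‖)) ?_ ?_ intervalIntegrable_const ?_
  · refine Eventually.of_forall fun n => ?_
    have := (tendsto_orbitSum hadd hweak hM i x le_rfl (hh n).1 (by linarith [(hh n).2])).1
    exact (intervalIntegrable_iff.1 this).aestronglyMeasurable
  · refine Eventually.of_forall fun n => ae_of_all _ fun s hs => ?_
    rw [uIoc_of_le zero_le_one] at hs
    exact ((e i).le_opNorm _).trans (mul_le_mul_of_nonneg_left (hM _ (orbit_time_mem le_rfl
      (hh n).1.le (by linarith [(hh n).2]) (Ioc_subset_Icc_self hs)) x) (norm_nonneg _))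
  · refine ae_of_all _ fun s hs => ?_
    rw [uIoc_of_le zero_le_one] at hs
    have h0 := tendsto_orbit_nhdsGT hadd hweak i x le_rfl
    rw [hS0] at h0
    refine h0.comp (tendsto_nhdsWithin_iff.2 ⟨?_, Eventually.of_forall fun n =>
      mem_Ioi.2 (by have := mul_pos (hh n).1 hs.1; linarith)⟩)
    simpa using hlim.mul_const s

omit hadd hweak in
theorem isClosed_setOf_tendsto_orbit :
    IsClosed {x | Tendsto (fun t => S t x) (𝓝[>] (0 : ℝ)) (𝓝 x)} := by
  refine isClosed_of_closure_subset fun x hx => ?_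
  rw [mem_ofPred_eq, Metric.tendsto_nhds]
  intro ε hε
  obtain ⟨y, hy, hxy⟩ := Metric.mem_closure_iff.1 hx (ε / (2 * (|M| + 1))) (by positivity)
  rw [dist_eq_norm, lt_div_iff₀ (by positivity)] at hxy
  filter_upwards [Metric.tendsto_nhds.1 hy (ε / 2) (half_pos hε),
    Ioo_mem_nhdsGT (zero_lt_one' ℝ)] with t ht ht1
  have h1 := hM t ⟨ht1.1.le, ht1.2⟩ (x - y)
  have h2 : M * ‖x - y‖ ≤ |M| * ‖x - y‖ := by gcongr; exact le_abs_self M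
  rw [dist_eq_norm] at ht ⊢
  have h3 : S t x - x = S t (x - y) + (S t y - y) - (x - y) := by rw [map_sub]; abel
  rw [h3]
  have h4 := norm_sub_le (S t (x - y) + (S t y - y)) (x - y)
  have h5 := norm_add_le (S t (x - y)) (S t y - y)
  nlinarith [norm_nonneg (x - y)]

omit hadd hweak hM in
theorem convex_setOf_tendsto_orbit :
    Convex ℝ {x | Tendsto (fun t => S t x) (𝓝[>] (0 : ℝ)) (𝓝 x)} := by
  intro x hx y hy a b _ _ _
  have h : Tendsto (fun t => (a : ℂ) • S t x + (b : ℂ) • S t y) (𝓝[>] (0 : ℝ))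
      (𝓝 ((a : ℂ) • x + (b : ℂ) • y)) :=
    (Tendsto.const_smul hx (a : ℂ)).add (Tendsto.const_smul hy (b : ℂ))
  simp only [Complex.coe_smul] at h
  refine h.congr fun t => ?_
  rw [map_add, (S t).map_smul_of_tower, (S t).map_smul_of_tower]

variable [CompleteSpace X] {p : ℝ} (hp : 0 < p)
    (hX : ∀ η : ℝ, 0 < η → ∃ C : ℝ, 0 ≤ C ∧ ∀ x y : X, ‖x - y‖ ^ p ≤ η * (‖x‖ ^ p + ‖y‖ ^ p) +
      C * ((‖x‖ ^ p + ‖y‖ ^ p) / 2 - ‖(2⁻¹ : ℂ) • (x + y)‖ ^ p))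
    (he : ∀ x y, (∀ i, e i x = e i y) → x = y)

include hp hX

theorem exists_forall_eval_eq_orbitMean (x : X) {a h : ℝ} (ha : 0 ≤ a) (hh : 0 < h)
    (hah : a + h < 1) : ∃ y, ‖y‖ ≤ M * ‖x‖ ∧ ∀ i, e i y = orbitMean (e i) S x a h := by
  obtain ⟨y, hy, hey⟩ := exists_mem_closure_convexHull_forall_eq hp hX
    (norm_orbitSum_le hM (x := x) ha hh.le hah)
    fun i => (tendsto_orbitSum hadd hweak hM i x ha hh hah).2
  refine ⟨y, ?_, hey⟩
  have hsub : closure (convexHull ℝ (range (orbitSum S x a h))) ⊆ closedBall 0 (M * ‖x‖) :=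
    closure_minimal (convexHull_min (by
      rintro _ ⟨n, rfl⟩
      simpa using norm_orbitSum_le hM (x := x) ha hh.le hah n) (convex_closedBall 0 _))
      isClosed_closedBall
  simpa using hsub hy

include he

theorem eval_apply_eq_orbitMean {x y : X} {a h u : ℝ} (ha : 0 ≤ a) (hh : 0 < h) (hu : 0 ≤ u)
    (huah : u + a + h < 1) (hy : ∀ i, e i y = orbitMean (e i) S x a h) (i : ι) :
    e i (S u y) = orbitMean (e i) S x (u + a) h := by
  refine eval_apply_eq_of_tendsto hp hX he
    (norm_orbitSum_le hM (x := x) ha hh.le (by linarith)) (fun j => ?_) (S u) ?_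
  · rw [hy]
    exact (tendsto_orbitSum hadd hweak hM j x ha hh (by linarith)).2
  · simp_rw [apply_orbitSum hadd ha hh.le hu]
    exact (tendsto_orbitSum hadd hweak hM i x (by positivity) hh huah).2

/-- Averages of orbits are points of strong continuity. -/
theorem tendsto_orbit_of_eval_eq_orbitMean {x y : X} {h : ℝ} (hh : 0 < h) (hh1 : h < 1)
    (hy : ∀ i, e i y = orbitMean (e i) S x 0 h) :
    Tendsto (fun t => S t y) (𝓝[>] (0 : ℝ)) (𝓝 y) := by
  rw [tendsto_iff_norm_sub_tendsto_zero]
  have hlim : Tendsto (fun u : ℝ => u / h * (2 * (M * ‖x‖))) (𝓝[>] (0 : ℝ)) (𝓝 0) := by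
    have : Tendsto (fun u : ℝ => u / h * (2 * (M * ‖x‖))) (𝓝 0)
      (𝓝 (0 / h * (2 * (M * ‖x‖)))) := (tendsto_id.div_const h).mul_const _
    rw [zero_div, zero_mul] at this
    exact this.mono_left nhdsWithin_le_nhds
  refine squeeze_zero' (Eventually.of_forall fun _ => norm_nonneg _) ?_ hlim
  filter_upwards [Ioo_mem_nhdsGT (sub_pos.2 hh1)] with u hu
  have hu0 : 0 < u := hu.1
  have hhu : h + u < 1 := by linarith [hu.2]
  obtain ⟨v, hv, hve⟩ :=
    exists_forall_eval_eq_orbitMean hadd hweak hM hp hX x hh.le hu0 hhu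
  obtain ⟨w, hw, hwe⟩ :=
    exists_forall_eval_eq_orbitMean hadd hweak hM hp hX x le_rfl hu0 (by linarith)
  have hkey : S u y - y = ((u / h : ℝ) : ℂ) • (v - w) := by
    refine he _ _ fun i => ?_
    have h1 := eval_apply_eq_orbitMean hadd hweak hM hp hX he le_rfl hh hu0.le
      (by linarith) hy i
    rw [add_zero] at h1
    have h2 := mul_orbitMean_sub hadd hweak hM i x hh hu0 hhu
    have hc : (h : ℂ) ≠ 0 := by exact_mod_cast hh.ne'
    rw [map_sub, map_smul, map_sub, h1, hy, hve, hwe, smul_eq_mul]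
    push_cast
    field_simp
    linear_combination h2
  rw [hkey, norm_smul, Complex.norm_real, Real.norm_of_nonneg (by positivity)]
  gcongr
  linarith [norm_sub_le v w]

/-- A locally bounded operator semigroup on a uniformly convex space that is continuous at zero
when tested against a separating family of functionals is strongly continuous. -/
theorem tendsto_orbit_of_weak (hS0 : ∀ x, S 0 x = x) (x : X) :
    Tendsto (fun t => S t x) (𝓝[>] (0 : ℝ)) (𝓝 x) := by
  set h : ℕ → ℝ := fun n => 1 / ((n + 1 : ℕ) + 1 : ℝ) with hh
  have hmem : ∀ n, h n ∈ Ioo (0 : ℝ) 1 := fun n => by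
    refine ⟨by positivity, (div_lt_one (by positivity)).2 ?_⟩
    push_cast
    linarith [Nat.cast_nonneg (α := ℝ) n]
  have hlim : Tendsto h atTop (𝓝 0) :=
    (tendsto_add_atTop_iff_nat 1).2 (tendsto_one_div_add_atTop_nhds_zero_nat (𝕜 := ℝ))
  choose y hyB hye using fun n => exists_forall_eval_eq_orbitMean hadd hweak hM hp hX x le_rfl
    (hmem n).1 (by linarith [(hmem n).2])
  obtain ⟨x', hx', hex'⟩ := exists_mem_closure_convexHull_forall_eq (e := e) hp hX hyB
    (c := fun i => e i x) fun i => by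
      simp_rw [hye]
      exact tendsto_orbitMean hadd hweak hM hS0 i x hmem hlim
  obtain rfl := he _ _ hex'
  refine closure_minimal (convexHull_min ?_ convex_setOf_tendsto_orbit)
    (isClosed_setOf_tendsto_orbit hM) hx'
  rintro _ ⟨n, rfl⟩
  exact tendsto_orbit_of_eval_eq_orbitMean hadd hweak hM hp hX he (hmem n).1 (hmem n).2 (hye n)

end WeaklyContinuousSemigroup

section StronglyContinuousSemigroup

variable {X : Type*} [NormedAddCommGroup X] [NormedSpace ℂ X] [CompleteSpace X]
  {S : ℝ → X →L[ℂ] X}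

/-- The uniform boundedness principle for operators converging strongly as `t → 0⁺`. -/
theorem exists_norm_le_of_tendsto_orbit
    (hlim : ∀ x, Tendsto (fun t => S t x) (𝓝[>] (0 : ℝ)) (𝓝 x)) :
    ∃ δ > 0, ∃ M, ∀ t ∈ Ioo 0 δ, ‖S t‖ ≤ M := by
  by_contra! hcon
  choose t ht hlt using fun n : ℕ => hcon (1 / ((n : ℝ) + 1)) (by positivity) n
  have ht0 : Tendsto t atTop (𝓝[>] 0) := tendsto_nhdsWithin_iff.2
    ⟨squeeze_zero (fun n => (ht n).1.le) (fun n => (ht n).2.le)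
      (tendsto_one_div_add_atTop_nhds_zero_nat (𝕜 := ℝ)), Eventually.of_forall fun n => (ht n).1⟩
  obtain ⟨C, hC⟩ := banach_steinhaus (g := fun n => S (t n)) fun x => by
    obtain ⟨C, hC⟩ := ((hlim x).comp ht0).norm.bddAbove_range
    exact ⟨C, fun n => hC ⟨n, rfl⟩⟩
  obtain ⟨n, hn⟩ := exists_nat_gt C
  exact absurd (hC n) (not_le.2 (hn.trans (hlt n)))

theorem exists_norm_le_of_strongly_continuous (hS0 : S 0 = ContinuousLinearMap.id ℂ X)
    (hadd : ∀ s, 0 ≤ s → ∀ t, 0 ≤ t → S (s + t) = (S s).comp (S t))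
    (hlim : ∀ x, Tendsto (fun t => S t x) (𝓝[>] (0 : ℝ)) (𝓝 x)) :
    ∃ M, ∀ t ∈ Ico (0 : ℝ) 1, ‖S t‖ ≤ M := by
  obtain ⟨δ, hδ, M, hM⟩ := exists_norm_le_of_tendsto_orbit hlim
  obtain ⟨n, hn⟩ := exists_nat_gt (1 / δ)
  have hn0 : (0 : ℝ) < n := (by positivity : 0 < 1 / δ).trans hn
  set K := max M 1 with hK
  have hsmall : ∀ t ∈ Ico (0 : ℝ) δ, ‖S t‖ ≤ K := by
    rintro t ⟨ht0, ht⟩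
    rcases ht0.eq_or_lt with rfl | ht0
    · rw [hS0]
      exact ContinuousLinearMap.norm_id_le.trans (le_max_right _ _)
    · exact (hM t ⟨ht0, ht⟩).trans (le_max_left _ _)
  have hpow : ∀ t ∈ Ico (0 : ℝ) δ, ∀ k : ℕ, ‖S (k * t)‖ ≤ K ^ k := by
    intro t ht k
    induction k with
    | zero =>
      rw [Nat.cast_zero, zero_mul, hS0, pow_zero]
      exact ContinuousLinearMap.norm_id_le
    | succ k ih =>
      rw [Nat.cast_succ, add_mul, one_mul, hadd _ (mul_nonneg k.cast_nonneg ht.1) t ht.1, pow_succ]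
      refine (ContinuousLinearMap.opNorm_comp_le _ _).trans ?_
      gcongr
      exact hsmall t ht
  refine ⟨K ^ n, fun t ht => ?_⟩
  have h := hpow (t / n) ⟨div_nonneg ht.1 hn0.le, ?_⟩ n
  · rwa [mul_div_cancel₀ _ hn0.ne'] at h
  · rw [div_lt_iff₀ hn0]
    rw [div_lt_iff₀ hδ] at hn
    linarith [ht.2]

end StronglyContinuousSemigroup

/-- Let `1 < p < ∞` and let `(T_t)_{t ≥ 0}` be an operator semigroup on the
Hardy space `H^p`.  Assume that for every `f ∈ H^p` and every `z ∈ 𝔻`, `T_t f(z) → f(z)` as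
`t → 0⁺`.  Then `(T_t)` is strongly continuous on `H^p` if and only if
`sup_{0 ≤ t < 1} ‖T_t‖ < ∞`. -/
theorem stmt1 (p : ℝ) (hp : 1 < p)
    (T : ℝ → (ℂ → ℂ) → (ℂ → ℂ))
    -- each `T t` maps `H^p` into `H^p`
    (hMaps : ∀ t, 0 ≤ t → ∀ f, MemHardy p f → MemHardy p (T t f))
    -- `T 0` is the identity
    (hId : ∀ f, MemHardy p f → ∀ z ∈ Metric.ball (0:ℂ) 1, T 0 f z = f z)
    -- the semigroup property `T (s+t) = T s ∘ T t`
    (hSemi : ∀ s, 0 ≤ s → ∀ t, 0 ≤ t → ∀ f, MemHardy p f →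
      ∀ z ∈ Metric.ball (0:ℂ) 1, T (s + t) f z = T s (T t f) z)
    -- each `T t` is linear
    (hAdd : ∀ t, 0 ≤ t → ∀ f g, MemHardy p f → MemHardy p g →
      ∀ z ∈ Metric.ball (0:ℂ) 1, T t (f + g) z = T t f z + T t g z)
    (hSMul : ∀ t, 0 ≤ t → ∀ (c : ℂ), ∀ f, MemHardy p f →
      ∀ z ∈ Metric.ball (0:ℂ) 1, T t (fun w => c * f w) z = c * T t f z)
    -- each `T t` is a bounded operator on `H^p`
    (hBdd : ∀ t, 0 ≤ t → ∃ C : ℝ, ∀ f, MemHardy p f →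
      hardyNorm p (T t f) ≤ C * hardyNorm p f)
    -- `T t` depends only on the restriction of its argument to the unit disk
    (hWellDef : ∀ t, 0 ≤ t → ∀ f g, MemHardy p f → MemHardy p g →
      (∀ z ∈ Metric.ball (0:ℂ) 1, f z = g z) →
      ∀ z ∈ Metric.ball (0:ℂ) 1, T t f z = T t g z)
    -- pointwise convergence `T_t f(z) → f(z)` as `t → 0⁺`
    (hPt : ∀ f, MemHardy p f → ∀ z ∈ Metric.ball (0:ℂ) 1,
      Tendsto (fun t => T t f z) (𝓝[>] (0:ℝ)) (𝓝 (f z))) :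
    -- strong continuity ↔ uniform boundedness of the norms for `0 ≤ t < 1`
    (∀ f, MemHardy p f →
      Tendsto (fun t => hardyNorm p (fun z => T t f z - f z)) (𝓝[>] (0:ℝ)) (𝓝 0)) ↔
    ∃ M : ℝ, ∀ t, 0 ≤ t → t < 1 → ∀ f, MemHardy p f →
      hardyNorm p (T t f) ≤ M * hardyNorm p f := by
  have : Fact (1 < p) := ⟨hp⟩
  have hp0 : 0 < p := zero_lt_one.trans hp
  have hex : ∀ t : ℝ, ∃ A : HardySpace p →L[ℂ] HardySpace p, 0 ≤ t →
      ∀ f, EqOn (A f).toFun (T t f.toFun) (ball 0 1) := fun t => by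
    by_cases ht : 0 ≤ t
    · obtain ⟨C, hC⟩ := hBdd t ht
      have hmk : ∀ f : HardySpace p, EqOn (HardySpace.mk (T t f.toFun)
          (hMaps t ht _ f.memHardy)).toFun (T t f.toFun) (ball 0 1) := fun f =>
        HardySpace.toFun_mk _
      refine ⟨LinearMap.mkContinuous
        { toFun := fun f => HardySpace.mk (T t f.toFun) (hMaps t ht _ f.memHardy)
          map_add' := fun f g => HardySpace.ext fun z hz => ?_
          map_smul' := fun c f => HardySpace.ext fun z hz => ?_ } C fun f => ?_, fun _ f => hmk f⟩
      · rw [hmk _ hz, HardySpace.toFun_add, HardySpace.toFun_add, Pi.add_apply, hmk _ hz, hmk _ hz]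
        exact hAdd t ht _ _ f.memHardy g.memHardy z hz
      · rw [hmk _ hz, HardySpace.toFun_smul, HardySpace.toFun_smul, Pi.smul_apply, RingHom.id_apply,
          hmk _ hz]
        exact hSMul t ht c _ f.memHardy z hz
      · exact (hardyNorm_congr (hmk f)).trans_le (hC _ f.memHardy)
    · exact ⟨0, fun h => absurd h ht⟩
  choose S hS using hex
  have hSmk : ∀ t, 0 ≤ t → ∀ f (hf : MemHardy p f),
      EqOn (S t (HardySpace.mk f hf)).toFun (T t f) (ball 0 1) := fun t ht f hf z hz =>
    (hS t ht _ hz).trans (hWellDef t ht _ _ (HardySpace.memHardy _) hf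
      (fun w hw => HardySpace.toFun_mk hf hw) z hz)
  have hS0 : ∀ x, S 0 x = x := fun f => HardySpace.ext fun z hz =>
    (hS 0 le_rfl f hz).trans (hId _ f.memHardy z hz)
  have hadd : ∀ s, 0 ≤ s → ∀ t, 0 ≤ t → ∀ x, S (s + t) x = S s (S t x) :=
    fun s hs t ht f => HardySpace.ext fun z hz => by
      rw [hS _ (add_nonneg hs ht) f hz, hS s hs _ hz, hSemi s hs t ht _ f.memHardy z hz]
      exact hWellDef s hs _ _ (hMaps t ht _ f.memHardy) (HardySpace.memHardy _)
        (fun w hw => (hS t ht f hw).symm) z hz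
  have hnorm : ∀ t, 0 ≤ t → ∀ f (hf : MemHardy p f),
      hardyNorm p (T t f) = ‖S t (HardySpace.mk f hf)‖ := fun t ht f hf =>
    (hardyNorm_congr (hSmk t ht f hf)).symm
  have hnorm_mk : ∀ f (hf : MemHardy p f), ‖HardySpace.mk f hf‖ = hardyNorm p f := fun f hf =>
    hardyNorm_congr (HardySpace.toFun_mk hf)
  constructor
  · intro h
    have hlim : ∀ x, Tendsto (fun t => S t x) (𝓝[>] (0 : ℝ)) (𝓝 x) := fun f => by
      rw [tendsto_iff_norm_sub_tendsto_zero]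
      refine (h _ f.memHardy).congr' ?_
      filter_upwards [self_mem_nhdsWithin] with t ht
      refine hardyNorm_congr fun z hz => ?_
      rw [HardySpace.toFun_sub, Pi.sub_apply, hS t (le_of_lt ht) f hz]
    obtain ⟨M, hM⟩ := exists_norm_le_of_strongly_continuous
      (ContinuousLinearMap.ext hS0)
      (fun s hs t ht => ContinuousLinearMap.ext (hadd s hs t ht)) hlim
    refine ⟨M, fun t ht ht1 f hf => ?_⟩
    rw [hnorm t ht f hf, ← hnorm_mk f hf]
    exact (S t).le_of_opNorm_le (hM t ⟨ht, ht1⟩) _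
  · rintro ⟨M, hM⟩ f hf
    have hweak : ∀ i x, Tendsto (fun t => HardySpace.eval i (S t x)) (𝓝[>] (0 : ℝ))
        (𝓝 (HardySpace.eval i x)) := fun i x => by
      refine (hPt _ x.memHardy i i.2).congr' ?_
      filter_upwards [self_mem_nhdsWithin] with t ht
      exact (hS t (le_of_lt ht) x i.2).symm
    have hbd : ∀ t ∈ Ico (0 : ℝ) 1, ∀ x, ‖S t x‖ ≤ M * ‖x‖ := fun t ht x =>
      (hardyNorm_congr (hS t ht.1 x)).trans_le (hM t ht.1 ht.2 _ x.memHardy)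
    have hlim := tendsto_orbit_of_weak hadd hweak hbd hp0
      (fun _ => HardySpace.exists_norm_sub_rpow_le)
      (fun _ _ => HardySpace.eq_of_eval_eq) hS0 (HardySpace.mk f hf)
    rw [tendsto_iff_norm_sub_tendsto_zero] at hlim
    refine hlim.congr' ?_
    filter_upwards [self_mem_nhdsWithin] with t ht
    refine hardyNorm_congr fun z hz => ?_
    rw [HardySpace.toFun_sub, Pi.sub_apply, hSmk t (le_of_lt ht) f hf hz,
      HardySpace.toFun_mk hf hz]
end
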